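/- arXiv:1301.3734 — 3 statements merged into one kernel-verified Lean document; each statement's English description precedes it below -/
import Mathlib

section
/- For every s > 0, the Brouncker continued fraction satisfies s + K_{n=1}^∞ ((2n−1)²/(2s)) = (8π²/Γ(1/4)⁴) · exp( ∫_0^s dt/(t + K_{n=1}^∞ (n²/t)) ), where for t > 0 the expression t + K_{n=1}^∞ (n²/t) denotes the limit of the convergents of the generalized continued fraction with integer part t, partial numerators a_n = n² and partial denominators b_n = t. -/
open Filter Real

/-- Numerators of the convergents of a generalized continued fraction with
integer part `b₀`, partial numerators `a n` and partial denominators `b n` (for `n ≥ 1`). -/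
noncomputable def cfNum (b₀ : ℝ) (a b : ℕ → ℝ) : ℕ → ℝ
  | 0 => b₀
  | 1 => b 1 * b₀ + a 1
  | n + 2 => b (n + 2) * cfNum b₀ a b (n + 1) + a (n + 2) * cfNum b₀ a b n

/-- Denominators of the convergents of a generalized continued fraction. -/
noncomputable def cfDen (a b : ℕ → ℝ) : ℕ → ℝ
  | 0 => 1
  | 1 => b 1
  | n + 2 => b (n + 2) * cfDen a b (n + 1) + a (n + 2) * cfDen a b n

/-- `IsCFLimit b₀ a b L` means: the convergents of the generalized continued fraction
`b₀ + a 1 / (b 1 + a 2 / (b 2 + ⋯))` tend to `L`. -/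
def IsCFLimit (b₀ : ℝ) (a b : ℕ → ℝ) (L : ℝ) : Prop :=
  Filter.Tendsto (fun n => cfNum b₀ a b n / cfDen a b n) Filter.atTop (nhds L)

open MeasureTheory intervalIntegral in
lemma bx_congr {f g : ℝ → ℝ} (h : ∀ x ∈ Set.Ioo (0:ℝ) 1, f x = g x) :
    ∫ x in (0:ℝ)..1, f x = ∫ x in (0:ℝ)..1, g x := by
  rw [integral_of_le zero_le_one, integral_of_le zero_le_one,
    integral_Ioc_eq_integral_Ioo, integral_Ioc_eq_integral_Ioo]
  exact setIntegral_congr_fun measurableSet_Ioo h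

noncomputable def bw (p c d v : ℝ) : ℝ := v ^ p * (1 - v) ^ c * (1 + v) ^ d

noncomputable def bJ (p c d : ℝ) : ℝ := ∫ v in (0:ℝ)..1, bw p c d v

lemma bw_pos {p c d v : ℝ} (hv : v ∈ Set.Ioo (0:ℝ) 1) : 0 < bw p c d v := by
  obtain ⟨h0, h1⟩ := hv
  have : 0 < 1 - v := by linarith
  unfold bw; positivity

lemma bw_half {p c d : ℝ} (hp : -1 < p) :
    IntervalIntegrable (fun v : ℝ => v ^ p * (1 - v) ^ c * (1 + v) ^ d) MeasureTheory.volume 0 (1/2) := by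
  refine ((intervalIntegral.intervalIntegrable_rpow' hp).mul_continuousOn ?_).mul_continuousOn ?_
  · rw [Set.uIcc_of_le (by norm_num)]
    refine ContinuousOn.rpow_const (by fun_prop) ?_
    intro x hx; left; have := hx.2; intro h; linarith
  · rw [Set.uIcc_of_le (by norm_num)]
    refine ContinuousOn.rpow_const (by fun_prop) ?_
    intro x hx; left; have := hx.1; intro h; linarith

lemma bw_half' {p c d : ℝ} (hc : -1 < c) :
    IntervalIntegrable (fun v : ℝ => v ^ p * (1 - v) ^ c * (1 + v) ^ d) MeasureTheory.volume (1/2) 1 := by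
  have h := (intervalIntegral.intervalIntegrable_rpow' (a := 1/2) (b := 0) hc).comp_sub_left 1
  norm_num at h
  have h2 : IntervalIntegrable (fun v : ℝ => (1 - v) ^ c * v ^ p * (1 + v) ^ d)
      MeasureTheory.volume (1/2) 1 := by
    refine ((by norm_num; exact h : IntervalIntegrable (fun v : ℝ => (1 - v) ^ c) MeasureTheory.volume (1/2) 1).mul_continuousOn ?_).mul_continuousOn ?_
    · rw [Set.uIcc_of_le (by norm_num)]
      refine ContinuousOn.rpow_const (by fun_prop) ?_
      intro x hx; left; have := hx.1; intro h; linarith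
    · rw [Set.uIcc_of_le (by norm_num)]
      refine ContinuousOn.rpow_const (by fun_prop) ?_
      intro x hx; left; have := hx.1; intro h; linarith
  convert h2 using 2 with v
  ring

lemma bw_int {p c d : ℝ} (hp : -1 < p) (hc : -1 < c) :
    IntervalIntegrable (bw p c d) MeasureTheory.volume 0 1 :=
  (bw_half hp).trans (bw_half' hc)

lemma bJ_pos {p c d : ℝ} (hp : -1 < p) (hc : -1 < c) : 0 < bJ p c d :=
  intervalIntegral.intervalIntegral_pos_of_pos_on (bw_int hp hc) (fun _ hx => bw_pos hx) one_pos

lemma bJ_c {p c d : ℝ} (hp : -1 < p) (hc : -1 < c) :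
    bJ p (c + 1) d = bJ p c d - bJ (p + 1) c d := by
  unfold bJ
  rw [← intervalIntegral.integral_sub (bw_int hp hc) (bw_int (by linarith) hc)]
  refine bx_congr fun v hv => ?_
  have h1 : 0 < 1 - v := by linarith [hv.2]
  unfold bw
  rw [rpow_add_one h1.ne', rpow_add_one hv.1.ne']
  ring

lemma bJ_d {p c d : ℝ} (hp : -1 < p) (hc : -1 < c) :
    bJ p c (d + 1) = bJ p c d + bJ (p + 1) c d := by
  unfold bJ
  rw [← intervalIntegral.integral_add (bw_int hp hc) (bw_int (by linarith) hc)]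
  refine bx_congr fun v hv => ?_
  have h1 : 0 < 1 + v := by linarith [hv.1]
  unfold bw
  rw [rpow_add_one h1.ne', rpow_add_one hv.1.ne']
  ring

lemma bJ_ftc {p c d : ℝ} (hp : 0 ≤ p) (hc : 0 < c) :
    p * bJ (p - 1) c d - c * bJ p (c - 1) d + d * bJ p c (d - 1) = - (0:ℝ) ^ p := by
  have i1 : IntervalIntegrable (fun v => p * bw (p - 1) c d v) MeasureTheory.volume 0 1 := by
    rcases hp.eq_or_lt with h | h
    · subst h; simp
    · exact (bw_int (by linarith) (by linarith)).const_mul _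
  have i2 : IntervalIntegrable (fun v => c * bw p (c - 1) d v) MeasureTheory.volume 0 1 :=
    (bw_int (by linarith) (by linarith)).const_mul _
  have i3 : IntervalIntegrable (fun v => d * bw p c (d - 1) v) MeasureTheory.volume 0 1 :=
    (bw_int (by linarith) (by linarith)).const_mul _
  have key := intervalIntegral.integral_eq_sub_of_hasDerivAt_of_le (f := bw p c d)
    (f' := fun v => p * bw (p - 1) c d v - c * bw p (c - 1) d v + d * bw p c (d - 1) v)
    zero_le_one ?_ ?_ ((i1.sub i2).add i3)
  · rw [intervalIntegral.integral_add (i1.sub i2) i3, intervalIntegral.integral_sub i1 i2] at key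
    simp only [intervalIntegral.integral_const_mul] at key
    unfold bJ
    rw [key]
    simp [bw, hc.ne']
  · unfold bw
    refine ContinuousOn.mul (ContinuousOn.mul ?_ ?_) ?_
    · exact ContinuousOn.rpow_const (by fun_prop) fun x _ => Or.inr hp
    · exact ContinuousOn.rpow_const (by fun_prop) fun x _ => Or.inr hc.le
    · exact ContinuousOn.rpow_const (by fun_prop) fun x hx => Or.inl (by linarith [hx.1])
  · intro v hv
    have h0 := hv.1
    have h1 : 0 < 1 - v := by linarith [hv.2]
    have h2 : 0 < 1 + v := by linarith [hv.1]
    have e0 := (hasDerivAt_id v).rpow_const (p := p) (Or.inl h0.ne')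
    have e1 := ((hasDerivAt_id v).const_sub 1).rpow_const (p := c) (Or.inl h1.ne')
    have e2 := ((hasDerivAt_id v).const_add 1).rpow_const (p := d) (Or.inl h2.ne')
    convert! (e0.mul e1).mul e2 using 1
    simp only [bw, id, Pi.mul_apply]
    ring

/-- `bI p t = ∫₀^∞ e^{-t x} tanh^p x sech x dx`. -/
noncomputable def bI (p t : ℝ) : ℝ := bJ p ((t - 1) / 2) (-(t + 1) / 2)

lemma bI_pos {p t : ℝ} (hp : -1 < p) (ht : -1 < t) : 0 < bI p t :=
  bJ_pos hp (by linarith)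

lemma bI_rec {p t : ℝ} (hp : 0 ≤ p) (ht : -1 < t) :
    p * bJ (p - 1) ((t + 1) / 2) ((1 - t) / 2) - t * bI p t - bI (p + 1) t = -(0:ℝ) ^ p := by
  have h := bJ_ftc (d := (1 - t) / 2) (c := (t + 1) / 2) hp (by linarith)
  have hc : -1 < (t - 1) / 2 := by linarith
  have h1 := bJ_d (p := p) (d := -(t + 1) / 2) (by linarith) hc
  have h2 := bJ_c (p := p) (d := -(t + 1) / 2) (by linarith) hc
  rw [show (t - 1) / 2 + 1 = (t + 1) / 2 by ring] at h2
  rw [show -(t + 1) / 2 + 1 = (1 - t) / 2 by ring] at h1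
  rw [show (1 - t) / 2 - 1 = -(t + 1) / 2 by ring,
    show (t + 1) / 2 - 1 = (t - 1) / 2 by ring, h1, h2] at h
  unfold bI
  rw [← h]; ring

lemma bI_rec0 {t : ℝ} (ht : -1 < t) : t * bI 0 t + bI 1 t = 1 := by
  have := bI_rec (p := 0) le_rfl ht
  norm_num at this
  linarith

lemma bI_rec1 {p t : ℝ} (hp : 0 < p) (ht : -1 < t) :
    p * bI (p - 1) t = t * bI p t + (p + 1) * bI (p + 1) t := by
  have h := bI_rec hp.le ht
  have hc : -1 < (t - 1) / 2 := by linarith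
  have h2 := bJ_c (p := p - 1) (d := (1 - t) / 2) (by linarith) hc
  have h3 := bJ_d (p := p - 1) (d := -(t + 1) / 2) (by linarith) hc
  have h4 := bJ_d (p := p) (d := -(t + 1) / 2) (by linarith) hc
  rw [show (t - 1) / 2 + 1 = (t + 1) / 2 by ring] at h2
  rw [show -(t + 1) / 2 + 1 = (1 - t) / 2 by ring] at h3 h4
  rw [sub_add_cancel] at h2 h3
  rw [h2, h3, h4, zero_rpow hp.ne'] at h
  unfold bI at *
  linarith

lemma bI_shift {t : ℝ} (ht : -1 < t) : bI 0 t + bI 0 (t + 2) = 2 / (t + 1) := by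
  have h := bJ_ftc (p := 0) (c := (t + 1) / 2) (d := -(t + 1) / 2) le_rfl (by linarith)
  have h0 : t + 1 ≠ 0 := by linarith
  unfold bI
  rw [show (t + 2 - 1) / 2 = (t + 1) / 2 by ring,
    show -(t + 2 + 1) / 2 = -(t + 1) / 2 - 1 by ring, show (t - 1) / 2 = (t + 1) / 2 - 1 by ring]
  rw [eq_div_iff h0]
  rw [zero_mul, rpow_zero] at h
  linarith

lemma bI_anti : AntitoneOn (bI 0) (Set.Ici 0) := by
  intro a ha b hb hab
  simp only [Set.mem_Ici] at ha hb
  refine intervalIntegral.integral_mono_on_of_le_Ioo zero_le_one (bw_int (by linarith) (by linarith))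
    (bw_int (by linarith) (by linarith)) fun v hv => ?_
  have h1 : 0 < 1 - v := by linarith [hv.2]
  have h2 : 1 ≤ 1 + v := by linarith [hv.1]
  unfold bw
  refine mul_le_mul (mul_le_mul_of_nonneg_left ?_ (by positivity)) ?_ (by positivity) ?_
  · exact rpow_le_rpow_of_exponent_ge h1 (by linarith [hv.1]) (by linarith)
  · exact rpow_le_rpow_of_exponent_le h2 (by linarith)
  · have := hv.1
    positivity

/-- Brouncker numerator identity. -/
lemma bK_one {s : ℝ} (hs : -1 < s) :
    s * bI (-1/2) s + bI (1/2) s = (s + 1) * bI (-1/2) (s + 2) := by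
  have h := bJ_ftc (p := 1/2) (c := (s + 1) / 2) (d := -(s + 1) / 2) (by norm_num) (by linarith)
  have hc : -1 < (s - 1) / 2 := by linarith
  have h1 := bJ_c (p := -1/2) (c := (s - 1) / 2) (d := -(s + 1) / 2) (by norm_num) hc
  have h2 := bJ_d (p := -1/2) (c := (s + 1) / 2) (d := -(s + 1) / 2 - 1) (by norm_num) (by linarith)
  rw [show (s - 1) / 2 + 1 = (s + 1) / 2 by ring] at h1
  rw [sub_add_cancel] at h2
  norm_num at h h1 h2
  rw [show (s + 1) / 2 - 1 = (s - 1) / 2 by ring] at h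
  unfold bI
  rw [show (s + 2 - 1) / 2 = (s + 1) / 2 by ring, show -(s + 2 + 1) / 2 = -(s + 1) / 2 - 1 by ring]
  norm_num
  have h3 : bJ (1/2) ((s + 1) / 2) (-(s + 1) / 2 - 1) = bJ (-(1/2)) ((s - 1) / 2) (-(s + 1) / 2)
      - bJ (1/2) ((s - 1) / 2) (-(s + 1) / 2) - bJ (-(1/2)) ((s + 1) / 2) (-(s + 1) / 2 - 1) := by
    norm_num
    linarith
  norm_num at h3
  rw [h3, h1] at h
  norm_num at h
  linarith

lemma bK_two {s : ℝ} (hs : -1 < s) :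
    (s + 3) * bI (-1/2) (s + 4) = (s + 1) * bI (-1/2) s := by
  have hc : -1 < (s - 1) / 2 := by linarith
  obtain ⟨c, hcc⟩ : ∃ c, c = (s - 1) / 2 := ⟨_, rfl⟩
  obtain ⟨d, hd⟩ : ∃ d, d = -(s + 5) / 2 := ⟨_, rfl⟩
  have h := bJ_ftc (p := 1/2) (c := c + 1) (d := d + 1) (by norm_num) (by linarith)
  have hc : -1 < c := by linarith
  have hc1 : -1 < c + 1 := by linarith
  unfold bI
  rw [show (s + 4 - 1) / 2 = c + 1 + 1 by rw [hcc]; ring, show -(s + 4 + 1) / 2 = d by rw [hd]; ring,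
    ← hcc, show -(s + 1) / 2 = d + 1 + 1 by rw [hd]; ring]
  rw [show (1/2 : ℝ) - 1 = -1/2 by norm_num, add_sub_cancel_right, add_sub_cancel_right] at h
  have n1 : (-1 : ℝ) < -1/2 := by norm_num
  have n2 : (-1 : ℝ) < 1/2 := by norm_num
  have e : (-1/2 : ℝ) + 1 = 1/2 := by norm_num
  have m (q : ℝ) (hq : -1 < q) := bJ_c (d := d) hq hc
  rw [bJ_c n1 hc, bJ_d n1 hc, bJ_d (by norm_num) hc, bJ_d (by norm_num) hc, bJ_c n2 hc, e] at h
  rw [bJ_c n1 hc1, bJ_c n1 hc, bJ_c (by norm_num) hc, bJ_d n1 hc, bJ_d n1 hc, bJ_d (by norm_num) hc, e]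
  rw [zero_rpow (by norm_num)] at h
  have hs : s = 2 * c + 1 := by rw [hcc]; ring
  have hd : d = -c - 3 := by rw [hd, hcc]; ring
  generalize bJ (-1/2) c d = e0 at *
  generalize bJ (1/2) c d = e1 at *
  generalize bJ (1/2 + 1) c d = e2 at *
  subst hs
  rw [hd] at h
  linear_combination 4 * h

lemma bcf_den_pos {a : ℕ → ℝ} {b : ℝ} (hb : 0 < b) (ha : ∀ n, 0 < a (n + 1)) (n : ℕ) :
    0 < cfDen a (fun _ => b) n := by
  induction n using Nat.strong_induction_on with
  | _ n ih =>
    match n with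
    | 0 => simp [cfDen]
    | 1 => simpa [cfDen]
    | n + 2 =>
      have h1 := ih (n + 1) (by omega)
      have h2 := ih n (by omega)
      have h3 := ha (n + 1)
      simp only [cfDen]
      positivity

lemma bcf_limit {a X : ℕ → ℝ} {b b₀ : ℝ} (hb : 0 < b) (ha : ∀ n, 0 < a (n + 1))
    (ha' : ∀ n : ℕ, a (n + 2) ≤ (2 * ((n : ℝ) + 2)) ^ 2) (hX : ∀ n, 0 < X (n + 1))
    (hrec : ∀ n, X (n + 1) = b + a (n + 2) / X (n + 2)) :
    IsCFLimit b₀ a (fun _ => b) (b₀ + a 1 / X 1) := by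
  set A := cfNum b₀ a (fun _ => b) with hA
  set B := cfDen a (fun _ => b) with hB
  set f := b₀ + a 1 / X 1 with hf
  have A0 : A 0 = b₀ := by simp [hA, cfNum]
  have A1 : A 1 = b * b₀ + a 1 := by simp [hA, cfNum]
  have A2 (n : ℕ) : A (n + 2) = b * A (n + 1) + a (n + 2) * A n := by simp [hA, cfNum]
  have B0 : B 0 = 1 := by simp [hB, cfDen]
  have B1 : B 1 = b := by simp [hB, cfDen]
  have B2 (n : ℕ) : B (n + 2) = b * B (n + 1) + a (n + 2) * B n := by simp [hB, cfDen]
  have Bpos : ∀ n, 0 < B n := bcf_den_pos hb ha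
  clear_value A B
  let P : ℕ → ℝ := fun n => ∏ k ∈ Finset.range n, a (k + 1)
  have P0 : P 0 = 1 := by simp [P]
  have PS (n : ℕ) : P (n + 1) = P n * a (n + 1) := by simp [P, Finset.prod_range_succ]
  have Ppos (n : ℕ) : 0 < P n := Finset.prod_pos fun k _ => ha k
  clear_value P
  -- remainders
  have hr (n : ℕ) : (A (n + 1) - f * B (n + 1)) * X (n + 2) = - a (n + 2) * (A n - f * B n) := by
    induction n with
    | zero =>
      have h1 := hX 0; have h2 := hX 1
      have h3 := hrec 0
      simp only [zero_add] at *
      have h4 : X 1 * X 2 = b * X 2 + a 2 := by rw [h3]; field_simp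
      rw [A0, A1, B0, B1, hf]
      field_simp
      linear_combination (a 1) * h4
    | succ n ih =>
      have h1 := hX (n + 1); have h2 := hX (n + 2)
      have h4 : X (n + 2) * X (n + 3) = b * X (n + 3) + a (n + 3) := by
        rw [hrec (n + 1)]; field_simp
      show (A (n + 2) - f * B (n + 2)) * X (n + 3) = - a (n + 3) * (A (n + 1) - f * B (n + 1))
      rw [A2, B2]
      linear_combination (X (n + 3)) * ih - (A (n + 1) - f * B (n + 1)) * h4
  have hbound (n : ℕ) : |A (n + 1) - f * B (n + 1)| * (X (n + 2) * B (n + 1) + a (n + 2) * B n)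
      = P (n + 2) := by
    have habs (n : ℕ) : |A (n + 1) - f * B (n + 1)| * X (n + 2) = a (n + 2) * |A n - f * B n| := by
      have := congrArg abs (hr n)
      rwa [abs_mul, abs_mul, abs_neg, abs_of_pos (hX (n + 1)), abs_of_pos (ha (n + 1))] at this
    induction n with
    | zero =>
      have h0 : |A 0 - f * B 0| * X 1 = a 1 := by
        rw [A0, B0, hf]
        have h1 := hX 0
        have h2 := ha 0
        simp only [zero_add] at h1 h2
        rw [show b₀ - (b₀ + a 1 / X 1) * 1 = -(a 1 / X 1) by ring, abs_neg, abs_of_pos (by positivity)]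
        field_simp
      have h3 := habs 0
      have h2 := hX 1
      have h4 : X 1 * X 2 = b * X 2 + a 2 := by rw [hrec 0]; field_simp
      simp only [zero_add] at *
      rw [PS, PS, P0, B0, B1, ← h0]
      have hx := hX 1
      have h6 : |A 1 - f * B 1| = a 2 * |A 0 - f * B 0| / X 2 := by
        rw [eq_div_iff h2.ne', h3]
      rw [B1] at h6
      rw [h6]; field_simp
      linear_combination (-(a 2 * |A 0 - f * B 0|)) * h4
    | succ n ih =>
      have h3 := habs (n + 1)
      have h2 := hX (n + 2)
      have h4 : X (n + 2) * X (n + 3) = b * X (n + 3) + a (n + 3) := by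
        rw [hrec (n + 1)]; field_simp
      have h6 : |A (n + 2) - f * B (n + 2)| = a (n + 3) * |A (n + 1) - f * B (n + 1)| / X (n + 3) := by
        rw [eq_div_iff h2.ne', h3]
      show |A (n + 2) - f * B (n + 2)| * (X (n + 3) * B (n + 2) + a (n + 3) * B (n + 1)) = P (n + 3)
      rw [PS, ← ih, h6, B2]
      field_simp
      linear_combination (-(B (n + 1) * a (n + 3) * |A (n + 1) - f * B (n + 1)|)) * h4
  -- growth
  let Q : ℕ → ℝ := fun n => B n * B (n + 1) / P (n + 1)
  let u : ℕ → ℝ := fun n => B n ^ 2 / P (n + 1)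
  have Qpos (n : ℕ) : 0 < Q n := div_pos (mul_pos (Bpos _) (Bpos _)) (Ppos _)
  have upos (n : ℕ) : 0 < u n := div_pos (pow_pos (Bpos _) _) (Ppos _)
  have hQu (n : ℕ) : Q (n + 1) = Q n + b * u (n + 1) := by
    have h1 := Ppos (n + 1); have h2 := ha (n + 1)
    simp only [Q, u]
    rw [B2, PS (n + 1)]
    field_simp
    ring
  have Qmono (n : ℕ) : Q n ≤ Q (n + 1) := by
    rw [hQu]; have := upos (n + 1); have : 0 < b * u (n + 1) := by positivity
    linarith
  have Q0 (n : ℕ) : Q 0 ≤ Q n := monotone_nat_of_le_succ Qmono (Nat.zero_le n)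
  have huu (n : ℕ) : Q 0 / ((n : ℝ) + 2) ≤ u n + u (n + 1) := by
    have h : u n * u (n + 1) * a (n + 2) = Q n ^ 2 := by
      have h1 := Ppos (n + 1); have h2 := ha (n + 1)
      simp only [Q, u]
      rw [PS (n + 1)]
      field_simp
    have h2 := ha' n
    have h3 := upos n
    have h4 := upos (n + 1)
    refine le_trans (div_le_div_of_nonneg_right (Q0 n) (by positivity)) ?_
    rw [div_le_iff₀ (by positivity)]
    refine le_of_sq_le_sq ?_ (by positivity)
    rw [← h]
    have : u n * u (n + 1) * a (n + 2) ≤ u n * u (n + 1) * (2 * ((n:ℝ) + 2)) ^ 2 :=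
      mul_le_mul_of_nonneg_left h2 (by positivity)
    nlinarith [mul_nonneg (sq_nonneg (u n - u (n + 1))) (sq_nonneg ((n:ℝ) + 2))]
  have hsum (n : ℕ) : b * Q 0 / 3 * (∑ i ∈ Finset.range n, 1 / ((i : ℝ) + 1)) ≤ Q n + Q (n + 1) := by
    have hbQ : 0 < b * Q 0 := mul_pos hb (Qpos 0)
    induction n with
    | zero =>
      have := Qpos 0; have := Qpos 1
      simp only [Finset.range_zero, Finset.sum_empty, zero_add]; linarith
    | succ n ih =>
      rw [Finset.sum_range_succ, mul_add]
      have h1 := hQu (n + 1)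
      have h2 := hQu n
      have h3 := mul_le_mul_of_nonneg_left (huu (n + 1)) hb.le
      have h4 : b * Q 0 / 3 * (1 / ((n:ℝ) + 1)) ≤ b * (Q 0 / (((n + 1 : ℕ):ℝ) + 2)) := by
        rw [div_mul_div_comm, mul_one, show b * (Q 0 / (((n + 1 : ℕ):ℝ) + 2)) = b * Q 0 / (((n + 1 : ℕ):ℝ) + 2) from (mul_div_assoc _ _ _).symm]
        push_cast
        refine div_le_div_of_nonneg_left hbQ.le (by positivity) ?_
        have : (0:ℝ) ≤ n := n.cast_nonneg
        linarith
      show _ ≤ Q (n + 1) + Q (n + 2)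
      have h1 : Q (n + 2) = Q (n + 1) + b * u (n + 2) := h1
      have h3 : b * (Q 0 / (((n + 1 : ℕ):ℝ) + 2)) ≤ b * (u (n + 1) + u (n + 2)) := h3
      linarith
  have hQ : Tendsto (fun n => Q (n + 1)) atTop atTop := by
    have h1 : Tendsto (fun n : ℕ => b * Q 0 / 3 / 2 * (∑ i ∈ Finset.range n, 1 / ((i : ℝ) + 1)))
        atTop atTop := by
      refine Tendsto.const_mul_atTop (by have := Qpos 0; positivity) ?_
      exact Real.tendsto_sum_range_one_div_nat_succ_atTop
    refine tendsto_atTop_mono (fun n => ?_) h1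
    linarith [hsum n, Qmono n]
  unfold IsCFLimit
  rw [← hA, ← hB] 
  refine (tendsto_add_atTop_iff_nat 1).1 ?_
  refine tendsto_iff_norm_sub_tendsto_zero.2 ?_
  refine squeeze_zero (fun _ => norm_nonneg _) (fun n => ?_) hQ.inv_tendsto_atTop
  have hBn := Bpos (n + 1)
  rw [Real.norm_eq_abs, show A (n + 1) / B (n + 1) - f = (A (n + 1) - f * B (n + 1)) / B (n + 1) by
    field_simp, abs_div, abs_of_pos hBn]
  have h5 : |A (n + 1) - f * B (n + 1)| * B (n + 2) ≤ P (n + 2) := by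
    rw [← hbound n]
    refine mul_le_mul_of_nonneg_left ?_ (abs_nonneg _)
    rw [B2, hrec (n + 1)]
    have h7 := ha (n + 2); have h8 := hX (n + 2)
    have : 0 < a (n + 3) / X (n + 3) := div_pos h7 h8
    nlinarith [mul_pos this hBn]
  simp only [Pi.inv_apply, Q]
  have hB2 := Bpos (n + 2)
  rw [inv_div, div_le_div_iff₀ hBn (by positivity)]
  calc |A (n + 1) - f * B (n + 1)| * (B (n + 1) * B (n + 1 + 1))
      = (|A (n + 1) - f * B (n + 1)| * B (n + 2)) * B (n + 1) := by ring
    _ ≤ _ := mul_le_mul_of_nonneg_right h5 hBn.le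

lemma bcf_g {t : ℝ} (ht : 0 < t) :
    IsCFLimit t (fun n => (n : ℝ) ^ 2) (fun _ => t) (1 / bI 0 t) := by
  have hp (n : ℕ) : 0 < bI (n : ℝ) t :=
    bI_pos (by have : (0:ℝ) ≤ n := n.cast_nonneg
               linarith) (by linarith)
  have h := bcf_limit (a := fun n => (n : ℝ) ^ 2) (b := t) (b₀ := t)
    (X := fun n => (n : ℝ) * bI ((n : ℝ) - 1) t / bI n t) ht ?_ ?_ ?_ ?_
  · convert h using 1
    have h0 := hp 0
    have h1 := hp 1
    have h2 := bI_rec0 (t := t) (by linarith)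
    norm_num at *
    field_simp
    linarith
  · intro n; positivity
  · intro n
    have : (0:ℝ) ≤ n := n.cast_nonneg
    push_cast
    nlinarith
  · intro n
    have h1 := hp (n + 1)
    have h0 := hp n
    push_cast at *
    rw [add_sub_cancel_right]
    positivity
  · intro n
    have h2 := hp (n + 2)
    have h1 := hp (n + 1)
    have h0 := hp n
    have h3 := bI_rec1 (p := (n:ℝ) + 1) (t := t) (by positivity) (by linarith)
    push_cast at *
    rw [show (n:ℝ) + 2 - 1 = n + 1 by ring]
    rw [add_sub_cancel_right] at *
    rw [show (n:ℝ) + 1 + 1 = n + 2 by ring] at h3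
    field_simp
    linarith

/-- value of Brouncker's continued fraction -/
noncomputable def bB (s : ℝ) : ℝ := s + bI (1/2) s / bI (-1/2) s

lemma bcf_B {s : ℝ} (hs : 0 < s) :
    IsCFLimit s (fun n => (2 * (n : ℝ) - 1) ^ 2) (fun _ => 2 * s) (bB s) := by
  have hp (n : ℕ) : 0 < bI ((n : ℝ) - 1/2) s :=
    bI_pos (by have : (0:ℝ) ≤ n := n.cast_nonneg
               linarith) (by linarith)
  have h := bcf_limit (a := fun n => (2 * (n : ℝ) - 1) ^ 2) (b := 2 * s) (b₀ := s)
    (X := fun n => (2 * (n : ℝ) - 1) * bI ((n : ℝ) - 1 - 1/2) s / bI (n - 1/2) s)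
      (by positivity) ?_ ?_ ?_ ?_
  · convert h using 1
    unfold bB
    norm_num
  · intro n
    have : (0:ℝ) ≤ n := n.cast_nonneg
    push_cast
    nlinarith
  · intro n
    have : (0:ℝ) ≤ n := n.cast_nonneg
    push_cast
    nlinarith
  · intro n
    have : (0:ℝ) ≤ n := n.cast_nonneg
    have h1 := hp (n + 1)
    have h0 := hp n
    push_cast at *
    rw [add_sub_cancel_right]
    have : 0 < 2 * ((n:ℝ) + 1) - 1 := by linarith
    positivity
  · intro n
    have : (0:ℝ) ≤ n := n.cast_nonneg
    have h2 := hp (n + 2)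
    have h1 := hp (n + 1)
    have h0 := hp n
    have h3 := bI_rec1 (p := (n:ℝ) + 1/2) (t := s) (by positivity) (by linarith)
    push_cast at *
    rw [show (n:ℝ) + 2 - 1 - 1/2 = n + 1/2 by ring, show (n:ℝ) + 2 - 1/2 = n + 3/2 by ring,
      show (n:ℝ) + 1 - 1 - 1/2 = n - 1/2 by ring, show (n:ℝ) + 1 - 1/2 = n + 1/2 by ring]
    rw [show (n:ℝ) + 2 - 1/2 = n + 3/2 by ring] at h2
    rw [show (n:ℝ) + 1 - 1/2 = n + 1/2 by ring] at h1
    rw [show (n:ℝ) + 1/2 + 1 = n + 3/2 by ring, show (n:ℝ) + 1/2 - 1 = n - 1/2 by ring] at h3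
    have h5 : 0 < 2 * ((n:ℝ) + 2) - 1 := by linarith
    generalize bI ((n:ℝ) + 1/2) s = y1 at *
    generalize bI ((n:ℝ) - 1/2) s = y0 at *
    generalize bI ((n:ℝ) + 3/2) s = y2 at *
    field_simp
    linarith

lemma bB_step {s : ℝ} (hs : 0 < s) : bB (s + 4) = bB s * ((s + 3) / (s + 1)) ^ 2 := by
  have hB {s : ℝ} (hs : 0 < s) : bB s = (s + 1) * bI (-1/2) (s + 2) / bI (-1/2) s := by
    have h0 : 0 < bI (-1/2) s := bI_pos (by norm_num) (by linarith)
    rw [← bK_one (by linarith), bB, add_div, mul_div_cancel_right₀ _ h0.ne']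
  have p0 : 0 < bI (-1/2) s := bI_pos (by norm_num) (by linarith)
  have p2 : 0 < bI (-1/2) (s + 2) := bI_pos (by norm_num) (by linarith)
  have p4 : 0 < bI (-1/2) (s + 4) := bI_pos (by norm_num) (by linarith)
  have h1 := bK_two (s := s) (by linarith)
  have h2 := bK_two (s := s + 2) (by linarith)
  rw [hB hs, hB (by linarith)]
  rw [show s + 2 + 4 = s + 6 by ring] at h2
  rw [show s + 4 + 2 = s + 6 by ring]
  have e4 : bI (-1/2) (s + 4) = (s + 1) * bI (-1/2) s / (s + 3) := by
    rw [eq_div_iff (by positivity)]; linarith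
  have e6 : bI (-1/2) (s + 6) = (s + 3) * bI (-1/2) (s + 2) / (s + 5) := by
    rw [eq_div_iff (by positivity)]; linarith
  rw [e4, e6]
  field_simp
  ring

lemma bB_ge {s : ℝ} (hs : 0 < s) : s ≤ bB s := by
  have p0 : 0 < bI (-1/2) s := bI_pos (by norm_num) (by linarith)
  have p1 : 0 < bI (1/2) s := bI_pos (by norm_num) (by linarith)
  unfold bB
  have := div_pos p1 p0
  linarith

lemma bB_le {s : ℝ} (hs : 1 ≤ s) : bB s ≤ s + 1 := by
  have p0 : 0 < bI (-1/2) s := bI_pos (by norm_num) (by linarith)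
  have p1 : 0 < bI (1/2) s := bI_pos (by norm_num) (by linarith)
  have p2 : 0 < bI (1/2 + 1) s := bI_pos (by norm_num) (by linarith)
  have h := bI_rec1 (p := 1/2) (t := s) (by norm_num) (by linarith)
  rw [show (1/2:ℝ) - 1 = -1/2 by norm_num] at h
  unfold bB
  have : bI (1/2) s / bI (-1/2) s ≤ 1 := by
    rw [div_le_one p0]
    nlinarith
  linarith

noncomputable def bF (k : ℕ) : ℝ := 4 * (Real.Gamma (k + 3/4) / Real.Gamma (k + 1/4)) ^ 2

lemma bGamma_cs {x : ℝ} (hx : 0 < x) :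
    Real.Gamma (x + 1/2) ^ 2 ≤ x * Real.Gamma x ^ 2 := by
  have h := Real.Gamma_mul_add_mul_le_rpow_Gamma_mul_rpow_Gamma (s := x) (t := x + 1)
    (a := 1/2) (b := 1/2) hx (by linarith) (by norm_num) (by norm_num) (by norm_num)
  have g0 := Real.Gamma_pos_of_pos hx
  have g1 := Real.Gamma_pos_of_pos (s := x + 1) (by linarith)
  have g2 := Real.Gamma_pos_of_pos (s := x + 1/2) (by linarith)
  rw [show 1/2 * x + 1/2 * (x + 1) = x + 1/2 by ring, ← Real.mul_rpow g0.le g1.le,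
    ← Real.sqrt_eq_rpow] at h
  have := (Real.le_sqrt g2.le (by positivity)).1 h
  rw [Real.Gamma_add_one hx.ne'] at this
  linarith

lemma bF_pos (k : ℕ) : 0 < bF k := by
  have g0 := Real.Gamma_pos_of_pos (s := (k:ℝ) + 1/4) (by positivity)
  have g1 := Real.Gamma_pos_of_pos (s := (k:ℝ) + 3/4) (by positivity)
  unfold bF; positivity

lemma bF_le (k : ℕ) : bF k ≤ 4 * k + 1 := by
  have g0 := Real.Gamma_pos_of_pos (s := (k:ℝ) + 1/4) (by positivity)
  have h := bGamma_cs (x := (k:ℝ) + 1/4) (by positivity)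
  rw [show (k:ℝ) + 1/4 + 1/2 = k + 3/4 by ring] at h
  unfold bF
  rw [div_pow, ← mul_div_assoc, div_le_iff₀ (by positivity)]
  linarith

lemma bF_ge {k : ℕ} (hk : 1 ≤ k) : 4 * (k:ℝ) - 1 ≤ bF k := by
  have hk' : (1:ℝ) ≤ k := by exact_mod_cast hk
  have g0 := Real.Gamma_pos_of_pos (s := (k:ℝ) + 1/4) (by positivity)
  have h := bGamma_cs (x := (k:ℝ) - 1/4) (by linarith)
  have h2 := Real.Gamma_add_one (s := (k:ℝ) - 1/4) (by linarith)
  rw [show (k:ℝ) - 1/4 + 1 = k + 3/4 by ring] at h2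
  rw [show (k:ℝ) - 1/4 + 1/2 = k + 1/4 by ring] at h
  unfold bF
  rw [div_pow, ← mul_div_assoc, le_div_iff₀ (by positivity), h2]
  have : 0 ≤ 4 * (k:ℝ) - 1 := by linarith
  nlinarith [mul_le_mul_of_nonneg_left h this]

lemma bF_step (k : ℕ) : bF (k + 1) = bF k * ((4 * k + 3) / (4 * k + 1)) ^ 2 := by
  have g0 := Real.Gamma_pos_of_pos (s := (k:ℝ) + 1/4) (by positivity)
  unfold bF
  push_cast
  rw [show (k:ℝ) + 1 + 3/4 = k + 3/4 + 1 by ring, show (k:ℝ) + 1 + 1/4 = k + 1/4 + 1 by ring,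
    Real.Gamma_add_one (by positivity), Real.Gamma_add_one (by positivity)]
  have : (k:ℝ) + 1/4 = (4 * k + 1) / 4 := by ring
  have e : ((k:ℝ) + 3/4) / (k + 1/4) = (4 * k + 3) / (4 * k + 1) := by
    rw [div_eq_div_iff (by positivity) (by positivity)]; ring
  rw [mul_div_mul_comm, e]
  ring

lemma bF_zero : bF 0 = 8 * π ^ 2 / Real.Gamma (1 / 4) ^ 4 := by
  have g0 := Real.Gamma_pos_of_pos (s := 1/4) (by positivity)
  have h := Real.Gamma_mul_Gamma_one_sub (1/4)
  rw [show (1:ℝ) - 1/4 = 3/4 by norm_num, show π * (1/4) = π / 4 by ring, Real.sin_pi_div_four] at h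
  have h2 : (Real.Gamma (1/4) * Real.Gamma (3/4)) ^ 2 = 2 * π ^ 2 := by
    rw [h, div_pow, div_pow, Real.sq_sqrt (by norm_num)]
    ring
  unfold bF
  simp only [Nat.cast_zero, zero_add]
  rw [eq_div_iff (by positivity), div_pow]
  field_simp
  linarith

lemma bI_ii {a b : ℝ} (ha : 0 ≤ a) (hb : 0 ≤ b) :
    IntervalIntegrable (bI 0) MeasureTheory.volume a b := by
  refine AntitoneOn.intervalIntegrable (bI_anti.mono ?_)
  intro x hx
  exact le_trans (le_min ha hb) hx.1

lemma bI_four {a : ℝ} (ha : 0 ≤ a) :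
    ∫ x in a..(a + 4), bI 0 x = 2 * (Real.log (a + 3) - Real.log (a + 1)) := by
  have h2 : IntervalIntegrable (bI 0) MeasureTheory.volume (a + 2) (a + 4) :=
    bI_ii (by linarith) (by linarith)
  rw [← intervalIntegral.integral_add_adjacent_intervals (b := a + 2)
    (bI_ii (by linarith) (by linarith)) h2]
  have e : ∫ x in (a + 2)..(a + 4), bI 0 x = ∫ x in a..(a + 2), bI 0 (x + 2) := by
    rw [intervalIntegral.integral_comp_add_right]; congr 1; ring
  have h3 : IntervalIntegrable (fun x => bI 0 (x + 2)) MeasureTheory.volume a (a + 2) := by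
    refine AntitoneOn.intervalIntegrable ?_
    rw [Set.uIcc_of_le (by linarith)]
    intro x hx y hy hxy
    exact bI_anti (Set.mem_Ici.2 (by linarith [hx.1])) (Set.mem_Ici.2 (by linarith [hy.1])) (by linarith)
  rw [e, ← intervalIntegral.integral_add (bI_ii (by linarith) (by linarith)) h3]
  rw [intervalIntegral.integral_eq_sub_of_hasDerivAt_of_le (f := fun x => 2 * Real.log (x + 1))
    (by linarith)]
  · rw [show a + 2 + 1 = a + 3 by ring]; ring
  · intro x hx
    refine (ContinuousAt.mul continuousAt_const (ContinuousAt.log (by fun_prop) ?_)).continuousWithinAt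
    linarith [hx.1]
  · intro x hx
    have hx0 : x + 1 ≠ 0 := by linarith [hx.1]
    rw [bI_shift (by linarith [hx.1])]
    convert! (((hasDerivAt_id x).add_const 1).log hx0).const_mul 2 using 1
    simp [div_eq_mul_inv]
  · exact (bI_ii (by linarith) (by linarith)).add h3

lemma bI_le {t : ℝ} (ht : 0 < t) : bI 0 t ≤ 1 / t := by
  have h := bI_rec0 (t := t) (by linarith)
  have p := bI_pos (p := 1) (t := t) (by norm_num) (by linarith)
  rw [le_div_iff₀ ht]
  linarith

lemma bB_eq {s : ℝ} (hs : 0 < s) : bB s = bF 0 * Real.exp (∫ t in (0:ℝ)..s, bI 0 t) := by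
  let E : ℕ → ℝ := fun k => Real.log (bB (s + 4 * k)) - Real.log (bF k)
    - ∫ x in (4 * (k:ℝ))..(4 * k + s), bI 0 x
  have hk0 (k : ℕ) : (0:ℝ) ≤ k := k.cast_nonneg
  have hBp (k : ℕ) : 0 < bB (s + 4 * k) := by
    have := bB_ge (s := s + 4 * k) (by positivity)
    have := hk0 k
    linarith
  have Estep (k : ℕ) : E (k + 1) = E k := by
    have hk := hk0 k
    have h1 := bB_step (s := s + 4 * k) (by positivity)
    have h2 := bF_step k
    have h3 := bI_four (a := 4 * k) (by positivity)
    have h4 := bI_four (a := 4 * k + s) (by positivity)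
    have i1 := intervalIntegral.integral_add_adjacent_intervals
      (bI_ii (a := 4 * k) (b := 4 * k + 4) (by positivity) (by positivity))
      (bI_ii (a := 4 * k + 4) (b := 4 * k + s + 4) (by positivity) (by positivity))
    have i2 := intervalIntegral.integral_add_adjacent_intervals
      (bI_ii (a := 4 * k) (b := 4 * k + s) (by positivity) (by positivity))
      (bI_ii (a := 4 * k + s) (b := 4 * k + s + 4) (by positivity) (by positivity))
    simp only [E]
    push_cast
    rw [show s + 4 * ((k:ℝ) + 1) = s + 4 * k + 4 by ring, h1, h2,
      show 4 * ((k:ℝ) + 1) = 4 * k + 4 by ring, show 4 * (k:ℝ) + 4 + s = 4 * k + s + 4 by ring,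
      Real.log_mul (hBp k).ne' (by positivity), Real.log_mul (bF_pos k).ne' (by positivity),
      Real.log_pow, Real.log_pow, Real.log_div (by positivity) (by positivity),
      Real.log_div (by positivity) (by positivity)]
    push_cast
    rw [show s + 4 * (k:ℝ) + 3 = 4 * k + s + 3 by ring, show s + 4 * (k:ℝ) + 1 = 4 * k + s + 1 by ring]
    linarith
  have Econst (k : ℕ) : E k = E 0 := by
    induction k with
    | zero => rfl
    | succ k ih => rw [Estep, ih]
  have hlin : Tendsto (fun k : ℕ => 4 * (k:ℝ)) atTop atTop :=
    tendsto_natCast_atTop_atTop.const_mul_atTop (by norm_num)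
  have hratio (a b : ℝ) : Tendsto (fun k : ℕ => (4 * (k:ℝ) + a) / (4 * k + b)) atTop (nhds 1) := by
    have h1 : Tendsto (fun k : ℕ => 1 + (a - b) / (4 * (k:ℝ) + b)) atTop (nhds (1 + 0)) :=
      tendsto_const_nhds.add (tendsto_const_nhds.div_atTop (tendsto_atTop_add_const_right _ b hlin))
    rw [add_zero] at h1
    refine h1.congr' ?_
    filter_upwards [(tendsto_atTop_add_const_right _ b hlin).eventually_gt_atTop 0] with k hk
    field_simp
    ring
  have t1 : Tendsto (fun k : ℕ => bB (s + 4 * k) / bF k) atTop (nhds 1) := by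
    refine tendsto_of_tendsto_of_tendsto_of_le_of_le' (hratio s 1) (hratio (s + 1) (-1)) ?_ ?_
    · filter_upwards with k
      have hk := hk0 k
      refine div_le_div₀ (hBp k).le ?_ (bF_pos k) (bF_le k)
      have := bB_ge (s := s + 4 * k) (by positivity)
      linarith
    · filter_upwards [eventually_ge_atTop 1] with k hk
      have hk' : (1:ℝ) ≤ k := by exact_mod_cast hk
      refine div_le_div₀ (by positivity) ?_ (by linarith) ?_
      · have := bB_le (s := s + 4 * k) (by linarith)
        linarith
      · linarith [bF_ge hk]
  have t2 : Tendsto (fun k : ℕ => Real.log (bB (s + 4 * k)) - Real.log (bF k)) atTop (nhds 0) := by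
    have := (Real.continuousAt_log one_ne_zero).tendsto.comp t1
    rw [Real.log_one] at this
    refine this.congr fun k => ?_
    exact Real.log_div (hBp k).ne' (bF_pos k).ne'
  have t3 : Tendsto (fun k : ℕ => ∫ x in (4 * (k:ℝ))..(4 * k + s), bI 0 x) atTop (nhds 0) := by
    have h0 : Tendsto (fun k : ℕ => s / (4 * (k:ℝ))) atTop (nhds 0) :=
      tendsto_const_nhds.div_atTop hlin
    refine tendsto_of_tendsto_of_tendsto_of_le_of_le' tendsto_const_nhds h0 ?_ ?_
    · filter_upwards with k
      have hk := hk0 k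
      refine intervalIntegral.integral_nonneg (by linarith) fun x hx => ?_
      exact (bI_pos (by norm_num) (by linarith [hx.1])).le
    · filter_upwards [eventually_ge_atTop 1] with k hk
      have hk' : (1:ℝ) ≤ k := by exact_mod_cast hk
      have := intervalIntegral.integral_mono_on (a := 4 * (k:ℝ)) (b := 4 * k + s) (by linarith)
        (bI_ii (by positivity) (by positivity)) (intervalIntegrable_const (c := 1 / (4 * (k:ℝ))))
        (fun x hx => (bI_le (by linarith [hx.1])).trans
          (one_div_le_one_div_of_le (by positivity) hx.1))
      refine this.trans (le_of_eq ?_)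
      rw [intervalIntegral.integral_const, smul_eq_mul]
      ring
  have hE : Tendsto E atTop (nhds (0 - 0)) := t2.sub t3
  have hE0 : E 0 = 0 := by
    have h1 : Tendsto E atTop (nhds (E 0)) := by
      rw [show E = fun _ => E 0 from funext Econst]; exact tendsto_const_nhds
    have := tendsto_nhds_unique h1 hE
    simpa using this
  simp only [E, Nat.cast_zero, mul_zero, add_zero, zero_add] at hE0
  have hB0 := hBp 0
  simp only [Nat.cast_zero, mul_zero, add_zero] at hB0
  rw [← Real.exp_log hB0, ← Real.exp_log (bF_pos 0), ← Real.exp_add]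
  congr 1
  linarith

theorem brouncker_exponential_formula (g : ℝ → ℝ)
    (hg : ∀ t : ℝ, 0 < t → IsCFLimit t (fun n => (n : ℝ) ^ 2) (fun _ => t) (g t))
    (s : ℝ) (hs : 0 < s) :
    IsCFLimit s (fun n => (2 * (n : ℝ) - 1) ^ 2) (fun _ => 2 * s)
      (8 * π ^ 2 / Real.Gamma (1 / 4) ^ 4 *
        Real.exp (∫ t in (0 : ℝ)..s, 1 / g t)) := by
  have hgt (t : ℝ) (ht : 0 < t) : 1 / g t = bI 0 t := by
    rw [tendsto_nhds_unique (hg t ht) (bcf_g ht), one_div_one_div]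
  have hint : ∫ t in (0 : ℝ)..s, 1 / g t = ∫ t in (0 : ℝ)..s, bI 0 t :=
    intervalIntegral.integral_congr_Ioo_of_le hs.le fun t ht => hgt t ht.1
  rw [hint, ← bF_zero, ← bB_eq hs]
  exact bcf_B hs
end

section
/- Define b(s) = 4·(Γ((3+s)/4)/Γ((1+s)/4))² for s > 0. Then for every s > 1, the second derivative of ln b at s equals −∫_0^∞ (x·e^{−sx}/cosh x) dx, and this quantity also equals −1/( s² − 1 + TK_{n=1}^∞ (4n²/1 + 4n²/(s²−1)) ), where TK_{n=1}^∞ (4n²/1 + 4n²/(s²−1)) denotes the limit of the convergents of the generalized continued fraction whose partial numerators are a_{2k−1} = a_{2k} = 4k² and whose partial denominators are b_{2k−1} = 1 and b_{2k} = s² − 1 for k ≥ 1. -/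
open Filter Real

theorem cf_den_pos (a b : ℕ → ℝ) (ha : ∀ n, 0 < a (n + 1)) (hb : ∀ n, 0 < b (n + 1)) (n : ℕ) :
    0 < cfDen a b n ∧ 0 < cfDen a b (n + 1) := by
  induction n with
  | zero => exact ⟨by simp [cfDen], by simpa [cfDen] using hb 0⟩
  | succ k ih =>
    refine ⟨ih.2, ?_⟩
    have h1 := mul_pos (hb (k + 1)) ih.2
    have h2 := mul_pos (ha (k + 1)) ih.1
    simp only [cfDen]
    exact add_pos h1 h2

theorem cf_tail (b₀ : ℝ) (a b Z : ℕ → ℝ) (h0 : Z 0 = b₀ * Z 1 + a 1 * Z 2)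
    (hZ : ∀ n, Z (n + 1) = b (n + 1) * Z (n + 2) + a (n + 2) * Z (n + 3)) (n : ℕ) :
    Z 0 = cfNum b₀ a b (n + 1) * Z (n + 2) + a (n + 2) * cfNum b₀ a b n * Z (n + 3) ∧
    Z 1 = cfDen a b (n + 1) * Z (n + 2) + a (n + 2) * cfDen a b n * Z (n + 3) := by
  induction n with
  | zero =>
    have h1 := hZ 0
    simp only [cfNum, cfDen, zero_add] at *
    constructor
    · rw [h0, h1]; ring
    · rw [h1]; ring
  | succ k ih =>
    have h1 := hZ (k + 1)
    obtain ⟨i1, i2⟩ := ih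
    simp only [cfNum, cfDen]
    constructor
    · rw [i1, show k + 2 = k + 1 + 1 from rfl, h1]; ring
    · rw [i2, show k + 2 = k + 1 + 1 from rfl, h1]; ring

theorem cf_value (b₀ : ℝ) (a b Z : ℕ → ℝ) (L : ℝ)
    (ha : ∀ n, 0 < a (n + 1)) (hb : ∀ n, 0 < b (n + 1)) (hpos : ∀ n, 0 < Z n)
    (h0 : Z 0 = b₀ * Z 1 + a 1 * Z 2)
    (hZ : ∀ n, Z (n + 1) = b (n + 1) * Z (n + 2) + a (n + 2) * Z (n + 3))
    (hL : IsCFLimit b₀ a b L) : Z 0 = L * Z 1 := by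
  have key : ∀ ε > 0, |Z 0 - L * Z 1| ≤ ε * Z 1 := by
    intro ε hε
    obtain ⟨N, hN⟩ := (Metric.tendsto_atTop.1 hL) ε hε
    have e : ∀ n ≥ N, |cfNum b₀ a b n - L * cfDen a b n| ≤ ε * cfDen a b n := by
      intro n hn
      have h := (hN n hn).le
      rw [Real.dist_eq] at h
      have hp := (cf_den_pos a b ha hb n).1
      have : cfNum b₀ a b n - L * cfDen a b n
          = (cfNum b₀ a b n / cfDen a b n - L) * cfDen a b n := by
        field_simp
      rw [this, abs_mul, abs_of_pos hp]
      gcongr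
    obtain ⟨t1, t2⟩ := cf_tail b₀ a b Z h0 hZ N
    have e1 := abs_le.1 (e N le_rfl)
    have e2 := abs_le.1 (e (N + 1) (by omega))
    have p2 := hpos (N + 2)
    have p3 := mul_pos (ha (N + 1)) (hpos (N + 3))
    have m1 := mul_le_mul_of_nonneg_right e2.1 p2.le
    have m2 := mul_le_mul_of_nonneg_right e2.2 p2.le
    have m3 := mul_le_mul_of_nonneg_right e1.1 p3.le
    have m4 := mul_le_mul_of_nonneg_right e1.2 p3.le
    rw [t1, t2, abs_le]
    constructor <;> ring_nf at m1 m2 m3 m4 ⊢ <;> linarith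
  have h1 := hpos 1
  have : |Z 0 - L * Z 1| ≤ 0 := by
    refine le_of_forall_pos_le_add fun δ hδ => ?_
    have := key (δ / Z 1) (by positivity)
    rw [div_mul_cancel₀ _ h1.ne'] at this
    linarith
  have := abs_nonpos_iff.1 this
  linarith

theorem eq_of_func_eq (F G : ℝ → ℝ) (p : ℝ → ℝ) (hF : ∀ t, 1 < t → F t + F (t + 2) = p t)
    (hG : ∀ t, 1 < t → G t + G (t + 2) = p t)
    (hF0 : Tendsto F atTop (nhds 0)) (hG0 : Tendsto G atTop (nhds 0)) (s : ℝ) (hs : 1 < s) :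
    F s = G s := by
  have h : ∀ n : ℕ, |F (s + 2 * n) - G (s + 2 * n)| = |F s - G s| := by
    intro n
    induction n with
    | zero => simp
    | succ k ih =>
      have hk : 1 < s + 2 * (k : ℝ) := by
        have : (0:ℝ) ≤ k := k.cast_nonneg
        linarith
      have h1 := hF _ hk
      have h2 := hG _ hk
      rw [← ih, ← abs_neg]
      congr 1
      push_cast
      rw [show s + 2 * ((k : ℝ) + 1) = s + 2 * k + 2 by ring]
      linarith
  have ht : Tendsto (fun n : ℕ => s + 2 * (n : ℝ)) atTop atTop :=
    tendsto_atTop_add_const_left _ _ (tendsto_natCast_atTop_atTop.const_mul_atTop two_pos)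
  have h3 := ((hF0.comp ht).sub (hG0.comp ht)).abs
  simp only [Function.comp_def, h, sub_zero, abs_zero] at h3
  have := tendsto_nhds_unique h3 tendsto_const_nhds
  have := abs_eq_zero.1 this.symm
  linarith

open MeasureTheory in
theorem int_xexp (t : ℝ) (ht : 0 < t) :
    IntegrableOn (fun x : ℝ => x * Real.exp (-t * x)) (Set.Ioi 0) ∧
    ∫ x in Set.Ioi (0 : ℝ), x * Real.exp (-t * x) = 1 / t ^ 2 := by
  constructor
  · have := integrableOn_rpow_mul_exp_neg_mul_rpow (p := 1) (s := 1) (b := t)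
      (by norm_num) one_pos ht
    simpa using this
  · have := Real.integral_rpow_mul_exp_neg_mul_Ioi (a := 2) (r := t) two_pos ht
    rw [Real.Gamma_two] at this
    rw [show (2 : ℝ) - 1 = 1 by norm_num] at this
    simp only [Real.rpow_one, mul_one, Real.rpow_two, neg_mul] at this ⊢
    rw [this, div_pow, one_pow]

open MeasureTheory in
theorem int_exp (t : ℝ) (ht : 0 < t) :
    IntegrableOn (fun x : ℝ => Real.exp (-t * x)) (Set.Ioi 0) ∧
    ∫ x in Set.Ioi (0 : ℝ), Real.exp (-t * x) = 1 / t := by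
  refine ⟨exp_neg_integrableOn_Ioi 0 ht, ?_⟩
  rw [integral_exp_mul_Ioi (by linarith)]
  simp

open MeasureTheory in
theorem int_div_cosh (f : ℝ → ℝ) (hc : Continuous f) (hf : IntegrableOn f (Set.Ioi 0)) :
    IntegrableOn (fun x : ℝ => f x / Real.cosh x) (Set.Ioi 0) := by
  refine Integrable.mono' hf.norm ?_ ?_
  · exact (hc.div Real.continuous_cosh (fun x => (Real.cosh_pos x).ne')).aestronglyMeasurable
  · refine Eventually.of_forall fun x => ?_
    rw [norm_div, Real.norm_of_nonneg (Real.cosh_pos x).le]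
    exact div_le_self (norm_nonneg _) (Real.one_le_cosh x)

open MeasureTheory in
theorem int_cosh_bound (f : ℝ → ℝ) (hc : Continuous f) (hf : IntegrableOn f (Set.Ioi 0))
    (h0 : ∀ x, 0 < x → 0 ≤ f x) :
    0 ≤ ∫ x in Set.Ioi (0 : ℝ), f x / Real.cosh x ∧
    ∫ x in Set.Ioi (0 : ℝ), f x / Real.cosh x ≤ ∫ x in Set.Ioi (0 : ℝ), f x := by
  constructor
  · exact setIntegral_nonneg measurableSet_Ioi fun x hx =>
      div_nonneg (h0 x hx) (Real.cosh_pos x).le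
  · exact setIntegral_mono_on (int_div_cosh f hc hf) hf measurableSet_Ioi fun x hx =>
      div_le_self (h0 x hx) (Real.one_le_cosh x)

theorem exp_cosh_id (t x : ℝ) :
    Real.exp (-t * x) / Real.cosh x + Real.exp (-(t + 2) * x) / Real.cosh x
      = 2 * Real.exp (-(t + 1) * x) := by
  have h := (Real.cosh_pos x).ne'
  rw [← add_div, div_eq_iff h, Real.cosh_eq]
  have e1 : Real.exp (-t * x) = Real.exp (-(t + 1) * x) * Real.exp x := by
    rw [← Real.exp_add]; ring_nf
  have e2 : Real.exp (-(t + 2) * x) = Real.exp (-(t + 1) * x) * Real.exp (-x) := by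
    rw [← Real.exp_add]; ring_nf
  rw [e1, e2]; ring

noncomputable def intE (t : ℝ) : ℝ := ∫ x in Set.Ioi (0 : ℝ), Real.exp (-t * x) / Real.cosh x
noncomputable def intJ (t : ℝ) : ℝ := ∫ x in Set.Ioi (0 : ℝ), x * Real.exp (-t * x) / Real.cosh x

open MeasureTheory in
theorem intE_func (t : ℝ) (ht : 0 < t) : intE t + intE (t + 2) = 2 / (t + 1) := by
  unfold intE
  rw [← integral_add (int_div_cosh _ (by fun_prop) (int_exp t ht).1)
    (int_div_cosh _ (by fun_prop) (int_exp (t + 2) (by linarith)).1)]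
  simp only [exp_cosh_id]
  rw [integral_const_mul, (int_exp (t + 1) (by linarith)).2]
  ring

open MeasureTheory in
theorem intJ_func (t : ℝ) (ht : 0 < t) : intJ t + intJ (t + 2) = 2 / (t + 1) ^ 2 := by
  unfold intJ
  rw [← integral_add (int_div_cosh _ (by fun_prop) (int_xexp t ht).1)
    (int_div_cosh _ (by fun_prop) (int_xexp (t + 2) (by linarith)).1)]
  have : ∀ x : ℝ, x * Real.exp (-t * x) / Real.cosh x + x * Real.exp (-(t + 2) * x) / Real.cosh x
      = 2 * (x * Real.exp (-(t + 1) * x)) := by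
    intro x
    rw [mul_div_assoc, mul_div_assoc, ← mul_add, exp_cosh_id]; ring
  simp only [this]
  rw [integral_const_mul, (int_xexp (t + 1) (by linarith)).2]
  ring

theorem intE_tendsto : Tendsto intE atTop (nhds 0) := by
  have h : Tendsto (fun t : ℝ => 1 / t) atTop (nhds 0) := by
    simpa using tendsto_inv_atTop_zero
  refine tendsto_of_tendsto_of_tendsto_of_le_of_le' tendsto_const_nhds h ?_ ?_
  · filter_upwards [eventually_gt_atTop 0] with t ht
    exact (int_cosh_bound _ (by fun_prop) (int_exp t ht).1 (fun x _ => (Real.exp_pos _).le)).1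
  · filter_upwards [eventually_gt_atTop 0] with t ht
    rw [← (int_exp t ht).2]
    exact (int_cosh_bound _ (by fun_prop) (int_exp t ht).1 (fun x _ => (Real.exp_pos _).le)).2

theorem intJ_tendsto : Tendsto intJ atTop (nhds 0) := by
  have h : Tendsto (fun t : ℝ => 1 / t ^ 2) atTop (nhds 0) := by
    simpa [Function.comp_def] using
      tendsto_inv_atTop_zero.comp (tendsto_pow_atTop (α := ℝ) two_ne_zero)
  refine tendsto_of_tendsto_of_tendsto_of_le_of_le' tendsto_const_nhds h ?_ ?_
  · filter_upwards [eventually_gt_atTop 0] with t ht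
    exact (int_cosh_bound _ (by fun_prop) (int_xexp t ht).1
      (fun x hx => mul_nonneg hx.le (Real.exp_pos _).le)).1
  · filter_upwards [eventually_gt_atTop 0] with t ht
    rw [← (int_xexp t ht).2]
    exact (int_cosh_bound _ (by fun_prop) (int_xexp t ht).1
      (fun x hx => mul_nonneg hx.le (Real.exp_pos _).le)).2

open MeasureTheory in
theorem intE_deriv (s : ℝ) (hs : 1 < s) : HasDerivAt intE (-intJ s) s := by
  have hd := hasDerivAt_integral_of_dominated_loc_of_deriv_le
    (μ := volume.restrict (Set.Ioi (0 : ℝ))) (𝕜 := ℝ)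
    (F := fun t x => Real.exp (-t * x) / Real.cosh x)
    (F' := fun t x => -(x * Real.exp (-t * x) / Real.cosh x)) (x₀ := s) (s := Set.Ioi 1)
    (bound := fun x => x * Real.exp (-1 * x)) (Ioi_mem_nhds hs) ?_ ?_ ?_ ?_ ?_ ?_
  · have := hd.2
    rw [integral_neg] at this
    exact this
  · refine Eventually.of_forall fun t => Continuous.aestronglyMeasurable ?_
    exact Continuous.div (by fun_prop) Real.continuous_cosh (fun x => (Real.cosh_pos x).ne')
  · exact int_div_cosh _ (by fun_prop) (int_exp s (by linarith)).1
  · refine Continuous.aestronglyMeasurable (Continuous.neg ?_)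
    exact Continuous.div (by fun_prop) Real.continuous_cosh (fun x => (Real.cosh_pos x).ne')
  · refine (ae_restrict_mem measurableSet_Ioi).mono fun x hx t ht => ?_
    have hx : 0 < x := hx
    have ht : 1 < t := ht
    rw [norm_neg, Real.norm_of_nonneg (by have := Real.cosh_pos x; positivity)]
    refine (div_le_self (by positivity) (Real.one_le_cosh x)).trans ?_
    gcongr
  · exact (int_xexp 1 one_pos).1
  · refine Eventually.of_forall fun x t _ => ?_
    have h1 : HasDerivAt (fun t : ℝ => -t * x) (-1 * x) t := (hasDerivAt_id t).neg.mul_const x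
    have := h1.exp.div_const (Real.cosh x)
    refine this.congr_deriv ?_
    ring

noncomputable def lgam : ℝ → ℝ := Real.log ∘ Real.Gamma

theorem lgam_diff (x : ℝ) (hx : 0 < x) : DifferentiableAt ℝ lgam x := by
  refine DifferentiableAt.log (Real.differentiableAt_Gamma fun m => ?_) (Real.Gamma_pos_of_pos hx).ne'
  have : (0 : ℝ) ≤ m := m.cast_nonneg
  linarith

theorem lgam_deriv_add_one (x : ℝ) (hx : 0 < x) : deriv lgam (x + 1) = 1 / x + deriv lgam x := by
  have h1 : HasDerivAt (fun y => lgam (y + 1)) (deriv lgam (x + 1)) x :=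
    (lgam_diff (x + 1) (by linarith)).hasDerivAt.comp_add_const x 1
  have h2 : HasDerivAt (fun y => Real.log y + lgam y) (x⁻¹ + deriv lgam x) x :=
    (Real.hasDerivAt_log hx.ne').add (lgam_diff x hx).hasDerivAt
  have he : (fun y => lgam (y + 1)) =ᶠ[nhds x] fun y => Real.log y + lgam y := by
    filter_upwards [Ioi_mem_nhds hx] with y hy
    have hy : 0 < y := hy
    simp only [lgam, Function.comp]
    rw [Real.Gamma_add_one hy.ne', Real.log_mul hy.ne' (Real.Gamma_pos_of_pos hy).ne']
  rw [one_div]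
  exact h1.unique (h2.congr_of_eventuallyEq he)

theorem lgam_mono : MonotoneOn (deriv lgam) (Set.Ioi 0) :=
  Real.convexOn_log_Gamma.monotoneOn_deriv lgam_diff

noncomputable def logB (t : ℝ) : ℝ :=
  Real.log (4 * (Real.Gamma ((3 + t) / 4) / Real.Gamma ((1 + t) / 4)) ^ 2)

noncomputable def logB' (t : ℝ) : ℝ := (deriv lgam ((3 + t) / 4) - deriv lgam ((1 + t) / 4)) / 2

theorem logB_deriv (t : ℝ) (ht : 0 < t) : HasDerivAt logB (logB' t) t := by
  have h1 : HasDerivAt (fun t : ℝ => (3 + t) / 4) (1 / 4) t :=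
    ((hasDerivAt_id t).const_add 3).div_const 4
  have h2 : HasDerivAt (fun t : ℝ => (1 + t) / 4) (1 / 4) t :=
    ((hasDerivAt_id t).const_add 1).div_const 4
  have g1 := (lgam_diff ((3 + t) / 4) (by linarith)).hasDerivAt.comp t h1
  have g2 := (lgam_diff ((1 + t) / 4) (by linarith)).hasDerivAt.comp t h2
  have g := ((g1.sub g2).const_mul 2).const_add (Real.log 4)
  have he : logB =ᶠ[nhds t] fun y => Real.log 4 + 2 * ((lgam ∘ fun t : ℝ => (3 + t) / 4) -
      (lgam ∘ fun t : ℝ => (1 + t) / 4)) y := by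
    filter_upwards [Ioi_mem_nhds ht] with y hy
    have hy : 0 < y := hy
    have p1 : 0 < Real.Gamma ((3 + y) / 4) := Real.Gamma_pos_of_pos (by linarith)
    have p2 : 0 < Real.Gamma ((1 + y) / 4) := Real.Gamma_pos_of_pos (by linarith)
    simp only [logB, lgam, Function.comp, Pi.sub_apply]
    rw [Real.log_mul (by norm_num) (by positivity), Real.log_pow, Real.log_div p1.ne' p2.ne']
    norm_num
  have := g.congr_of_eventuallyEq he
  refine this.congr_deriv ?_
  unfold logB'
  ring

theorem logB'_func (t : ℝ) (ht : 0 < t) : logB' t + logB' (t + 2) = 2 / (t + 1) := by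
  have h := lgam_deriv_add_one ((1 + t) / 4) (by linarith)
  unfold logB'
  rw [show (3 + (t + 2)) / 4 = (1 + t) / 4 + 1 by ring, h,
    show (1 + (t + 2)) / 4 = (3 + t) / 4 by ring]
  field_simp
  ring

theorem logB'_tendsto : Tendsto logB' atTop (nhds 0) := by
  have h : Tendsto (fun t : ℝ => 2 / t) atTop (nhds 0) := tendsto_const_nhds.div_atTop tendsto_id
  have nn : ∀ t : ℝ, 0 < t → 0 ≤ logB' t := by
    intro t ht
    have := lgam_mono (show (1 + t) / 4 ∈ Set.Ioi 0 from by simp; linarith)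
      (show (3 + t) / 4 ∈ Set.Ioi 0 from by simp; linarith) (by linarith)
    unfold logB'
    linarith
  refine tendsto_of_tendsto_of_tendsto_of_le_of_le' tendsto_const_nhds h ?_ ?_
  · filter_upwards [eventually_gt_atTop 0] with t ht using nn t ht
  · filter_upwards [eventually_gt_atTop 0] with t ht
    have h1 := logB'_func t ht
    have h2 := nn (t + 2) (by linarith)
    have h3 : 2 / (t + 1) ≤ 2 / t := by gcongr; linarith
    linarith

theorem part_one (s : ℝ) (hs : 1 < s) : deriv (deriv logB) s = -intJ s := by
  have he : deriv logB =ᶠ[nhds s] intE := by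
    filter_upwards [Ioi_mem_nhds hs] with t ht
    have ht : 1 < t := ht
    rw [(logB_deriv t (by linarith)).deriv]
    exact eq_of_func_eq logB' intE (fun t => 2 / (t + 1)) (fun t ht => logB'_func t (by linarith))
      (fun t ht => intE_func t (by linarith)) logB'_tendsto intE_tendsto t ht
  rw [he.deriv_eq]
  exact (intE_deriv s hs).deriv

noncomputable def uu (a : ℝ) (j : ℕ) : ℝ :=
  Real.Gamma (a + j) ^ 2 / ((j.factorial : ℝ) * Real.Gamma (2 * a + j))

theorem uu_pos (a : ℝ) (ha : 1 < a) (j : ℕ) : 0 < uu a j := by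
  have hj : (0 : ℝ) ≤ j := j.cast_nonneg
  have h1 : 0 < Real.Gamma (a + j) := Real.Gamma_pos_of_pos (by linarith)
  have h2 : 0 < Real.Gamma (2 * a + j) := Real.Gamma_pos_of_pos (by linarith)
  have h3 : (0 : ℝ) < j.factorial := by exact_mod_cast j.factorial_pos
  unfold uu
  positivity

theorem uu_succ (a : ℝ) (ha : 1 < a) (j : ℕ) :
    uu a (j + 1) = uu a j * (a + j) ^ 2 / ((j + 1) * (2 * a + j)) := by
  have hj : (0 : ℝ) ≤ j := j.cast_nonneg
  have h2 : 0 < Real.Gamma (2 * a + j) := Real.Gamma_pos_of_pos (by linarith)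
  have h3 : (0 : ℝ) < j.factorial := by exact_mod_cast j.factorial_pos
  have h4 : 0 < 2 * a + j := by linarith
  unfold uu
  push_cast [Nat.factorial_succ]
  rw [← add_assoc, ← add_assoc, Real.Gamma_add_one (by linarith), Real.Gamma_add_one (by linarith)]
  field_simp

theorem uu_shift (a : ℝ) (ha : 1 < a) (j : ℕ) :
    uu (a + 1) j = uu a j * (a + j) ^ 2 / ((2 * a + j) * (2 * a + j + 1)) := by
  have hj : (0 : ℝ) ≤ j := j.cast_nonneg
  have h2 : 0 < Real.Gamma (2 * a + j) := Real.Gamma_pos_of_pos (by linarith)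
  have h3 : (0 : ℝ) < j.factorial := by exact_mod_cast j.factorial_pos
  have h4 : 0 < 2 * a + j := by linarith
  unfold uu
  rw [show a + 1 + (j : ℝ) = a + j + 1 by ring, show 2 * (a + 1) + (j : ℝ) = 2 * a + j + 1 + 1 by ring,
    Real.Gamma_add_one (by linarith), Real.Gamma_add_one (by linarith),
    Real.Gamma_add_one (by linarith)]
  field_simp

theorem gamma_prod (a : ℝ) (ha : 0 < a) (n : ℕ) :
    Real.Gamma (a + n) = Real.Gamma a * ∏ j ∈ Finset.range n, (a + j) := by
  induction n with
  | zero => simp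
  | succ k ih =>
    have hj : (0 : ℝ) ≤ k := k.cast_nonneg
    push_cast
    rw [← add_assoc, Real.Gamma_add_one (by linarith), ih, Finset.prod_range_succ]
    ring

theorem gamma_ratio (a : ℝ) (ha : 0 < a) :
    Tendsto (fun n : ℕ => Real.Gamma (a + ((n + 1 : ℕ) : ℝ)) / ((n : ℝ) ^ a * n.factorial)) atTop
      (nhds 1) := by
  have hG := Real.Gamma_pos_of_pos ha
  have h := (tendsto_const_nhds (x := Real.Gamma a)).div (Real.GammaSeq_tendsto_Gamma a) hG.ne'
  rw [div_self hG.ne'] at h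
  refine h.congr fun n => ?_
  simp only [Pi.div_apply]
  rw [gamma_prod a ha, Real.GammaSeq]
  rw [div_div_eq_mul_div]

theorem uu_lim (a : ℝ) (ha : 1 < a) : Tendsto (fun j : ℕ => (j : ℝ) * uu a j) atTop (nhds 1) := by
  rw [← tendsto_add_atTop_iff_nat 1]
  have h := ((gamma_ratio a (by linarith)).pow 2).div (gamma_ratio (2 * a) (by linarith)) one_ne_zero
  rw [one_pow, div_one] at h
  refine h.congr' ?_
  filter_upwards [eventually_gt_atTop 0] with n hn
  have hn : (0 : ℝ) < n := by exact_mod_cast hn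
  have h3 : (0 : ℝ) < n.factorial := by exact_mod_cast n.factorial_pos
  have hp : 0 < (n : ℝ) ^ a := Real.rpow_pos_of_pos hn a
  have h2 : 0 < Real.Gamma (2 * a + ((n + 1 : ℕ) : ℝ)) :=
    Real.Gamma_pos_of_pos (by push_cast; linarith)
  simp only [Pi.div_apply]
  rw [two_mul a, Real.rpow_add hn, ← two_mul a, uu, Nat.factorial_succ]
  push_cast at *
  field_simp

theorem lin_ratio (p q : ℝ) : Tendsto (fun j : ℕ => ((j : ℝ) + p) / (j + q)) atTop (nhds 1) := by
  have hq : Tendsto (fun j : ℕ => (j : ℝ) + q) atTop atTop :=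
    tendsto_atTop_add_const_right _ _ tendsto_natCast_atTop_atTop
  have h : Tendsto (fun j : ℕ => 1 + (p - q) / ((j : ℝ) + q)) atTop (nhds (1 + 0)) :=
    tendsto_const_nhds.add (tendsto_const_nhds.div_atTop hq)
  rw [add_zero] at h
  refine h.congr' ?_
  filter_upwards [hq.eventually_gt_atTop 0] with j hj
  field_simp
  ring

noncomputable def bet : ℕ → ℝ → ℝ
  | 0, x => 1 / x
  | n + 1, x => bet n x * (n + 1) / (x + n + 1)

theorem bet_pos (n : ℕ) (x : ℝ) (hx : 0 < x) : 0 < bet n x := by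
  induction n with
  | zero => simp [bet, hx]
  | succ k ih => simp only [bet]; positivity

theorem bet_shift (n : ℕ) (x : ℝ) (hx : 0 < x) : bet n (x + 1) = bet n x * x / (x + n + 1) := by
  induction n with
  | zero => simp [bet, hx.ne']
  | succ k ih =>
    simp only [bet]; rw [ih]; push_cast
    have h1 : x + 1 + k + 1 = x + (k + 1) + 1 := by ring
    rw [h1]
    field_simp

theorem bet_anti (n : ℕ) (x : ℝ) (hx : 0 < x) : bet (n + 1) x ≤ bet n x := by
  have := bet_pos n x hx
  simp only [bet]
  rw [div_le_iff₀ (by positivity)]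
  have : 0 ≤ bet n x * x := by positivity
  nlinarith

theorem bet_le_zero (n : ℕ) (x : ℝ) (hx : 0 < x) : bet n x ≤ 1 / x := by
  induction n with
  | zero => simp [bet]
  | succ k ih => exact (bet_anti k x hx).trans ih

theorem bet_le_one (n : ℕ) (x : ℝ) (hx : 0 < x) : bet (n + 1) x ≤ 1 / x / (x + 1) := by
  induction n with
  | zero => simp [bet]
  | succ k ih => exact (bet_anti (k + 1) x hx).trans ih

/-- telescoping certificate -/
noncomputable def TT (a : ℝ) (n j : ℕ) : ℝ := uu a j * bet n (a + j) * j * (2 * a + j - 1)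

theorem TT_diff (a : ℝ) (ha : 1 < a) (n j : ℕ) :
    TT a n (j + 1) - TT a n j =
      a * (a - 1) * (uu a j * bet n (a + j)) +
      (n + 1) ^ 2 * (uu a j * (bet n (a + j) * (a + j) / (a + j + n + 1)))
      - n * (uu a j * (bet n (a + j) * (a + j))) := by
  have hj : (0 : ℝ) ≤ j := j.cast_nonneg
  have hx : 0 < a + j := by linarith
  have h4 : 0 < 2 * a + j := by linarith
  unfold TT
  rw [uu_succ a ha]
  push_cast
  rw [← add_assoc, bet_shift n (a + j) hx]
  field_simp
  ring

theorem sum_TT (a : ℝ) (ha : 1 < a) (n N : ℕ) :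
    ∑ j ∈ Finset.range N, (a * (a - 1) * (uu a j * bet n (a + j)) +
      (n + 1) ^ 2 * (uu a j * (bet n (a + j) * (a + j) / (a + j + n + 1)))
      - n * (uu a j * (bet n (a + j) * (a + j)))) = TT a n N := by
  simp only [← TT_diff a ha]
  rw [Finset.sum_range_sub]
  simp [TT]

theorem TT_zero_lim (a : ℝ) (ha : 1 < a) : Tendsto (fun j => TT a 0 j) atTop (nhds 1) := by
  have h := (uu_lim a ha).mul (lin_ratio (2 * a - 1) a)
  rw [one_mul] at h
  refine h.congr fun j => ?_
  simp only [TT, bet]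
  rw [show (j : ℝ) + (2 * a - 1) = 2 * a + j - 1 by ring, add_comm (j : ℝ) a]
  ring

theorem TT_succ_lim (a : ℝ) (ha : 1 < a) (n : ℕ) :
    Tendsto (fun j => TT a (n + 1) j) atTop (nhds 0) := by
  have hq : Tendsto (fun j : ℕ => (j : ℝ) + (a + 1)) atTop atTop :=
    tendsto_atTop_add_const_right _ _ tendsto_natCast_atTop_atTop
  have h := (TT_zero_lim a ha).div_atTop hq
  refine tendsto_of_tendsto_of_tendsto_of_le_of_le tendsto_const_nhds h (fun j => ?_) (fun j => ?_)
  · have hj : (0 : ℝ) ≤ j := j.cast_nonneg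
    have := uu_pos a ha j
    have := bet_pos (n + 1) (a + j) (by linarith)
    have : 0 < 2 * a + j - 1 := by linarith
    simp only [TT]; positivity
  · have hj : (0 : ℝ) ≤ j := j.cast_nonneg
    have := uu_pos a ha j
    have hb := bet_le_one n (a + j) (by linarith)
    have : 0 < 2 * a + j - 1 := by linarith
    have e : TT a 0 j / (j + (a + 1)) = uu a j * (1 / (a + j) / (a + j + 1)) * j * (2 * a + j - 1) := by
      simp only [TT, bet]
      rw [show (j : ℝ) + (a + 1) = a + j + 1 by ring]
      ring
    rw [e]
    unfold TT
    gcongr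

theorem hasSum_XX (a : ℝ) (ha : 1 < a) :
    HasSum (fun j : ℕ => a * (a - 1) * (uu a j * bet 0 (a + j)) +
      (uu a j * (bet 0 (a + j) * (a + j) / (a + j + 0 + 1)))) 1 := by
  have ha' : 0 < a - 1 := by linarith
  rw [hasSum_iff_tendsto_nat_of_nonneg]
  · refine (TT_zero_lim a ha).congr fun N => ?_
    rw [← sum_TT a ha]
    simp
  · intro j
    have hj : (0 : ℝ) ≤ j := j.cast_nonneg
    have := uu_pos a ha j
    have := bet_pos 0 (a + j) (by linarith)
    positivity

theorem summable_base (a : ℝ) (ha : 1 < a) : Summable (fun j : ℕ => uu a j * (1 / (a + j))) := by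
  have ha' : 0 < a - 1 := by linarith
  have hp : 0 < a * (a - 1) := by positivity
  have h := (hasSum_XX a ha).summable
  have h2 : Summable (fun j : ℕ => a * (a - 1) * (uu a j * (1 / (a + j)))) := by
    refine Summable.of_nonneg_of_le (fun j => ?_) (fun j => ?_) h
    · have hj : (0 : ℝ) ≤ j := j.cast_nonneg
      have := uu_pos a ha j
      positivity
    · have hj : (0 : ℝ) ≤ j := j.cast_nonneg
      have := uu_pos a ha j
      have := bet_pos 0 (a + j) (by linarith)
      have : 0 ≤ (uu a j * (bet 0 (a + j) * (a + j) / (a + j + 0 + 1))) := by positivity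
      simp only [bet] at *
      linarith
  exact (summable_mul_left_iff hp.ne').1 h2

theorem summable_even (a : ℝ) (ha : 1 < a) (n : ℕ) :
    Summable (fun j : ℕ => uu a j * bet n (a + j)) := by
  refine Summable.of_nonneg_of_le (fun j => ?_) (fun j => ?_) (summable_base a ha)
  · have hj : (0 : ℝ) ≤ j := j.cast_nonneg
    have := uu_pos a ha j
    have := bet_pos n (a + j) (by linarith)
    positivity
  · have hj : (0 : ℝ) ≤ j := j.cast_nonneg
    have := uu_pos a ha j
    have := bet_le_zero n (a + j) (by linarith)
    gcongr

theorem odd_eq (a : ℝ) (ha : 1 < a) (n j : ℕ) :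
    uu a j * (bet n (a + j) * (a + j) / (a + j + n + 1)) =
      uu a j * bet n (a + j) - uu a j * bet (n + 1) (a + j) := by
  have hj : (0 : ℝ) ≤ j := j.cast_nonneg
  simp only [bet]
  field_simp
  ring

theorem summable_odd (a : ℝ) (ha : 1 < a) (n : ℕ) :
    Summable (fun j : ℕ => uu a j * (bet n (a + j) * (a + j) / (a + j + n + 1))) := by
  simp only [odd_eq a ha]
  exact (summable_even a ha n).sub (summable_even a ha (n + 1))

noncomputable def XE (a : ℝ) (n : ℕ) : ℝ := ∑' j : ℕ, uu a j * bet n (a + j)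
noncomputable def XO (a : ℝ) (n : ℕ) : ℝ :=
  ∑' j : ℕ, uu a j * (bet n (a + j) * (a + j) / (a + j + n + 1))

theorem XE_pos (a : ℝ) (ha : 1 < a) (n : ℕ) : 0 < XE a n := by
  have h : ∀ j : ℕ, 0 < uu a j * bet n (a + j) := fun j =>
    mul_pos (uu_pos a ha j) (bet_pos n _ (by have : (0 : ℝ) ≤ j := j.cast_nonneg
                                             linarith))
  exact (summable_even a ha n).tsum_pos (fun j => (h j).le) 0 (h 0)

theorem XO_pos (a : ℝ) (ha : 1 < a) (n : ℕ) : 0 < XO a n := by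
  have h : ∀ j : ℕ, 0 < uu a j * (bet n (a + j) * (a + j) / (a + j + n + 1)) := fun j => by
    have hj : (0 : ℝ) ≤ j := j.cast_nonneg
    have := uu_pos a ha j
    have := bet_pos n (a + j) (by linarith)
    positivity
  exact (summable_odd a ha n).tsum_pos (fun j => (h j).le) 0 (h 0)

theorem XE_rec (a : ℝ) (ha : 1 < a) (n : ℕ) : XE a n = XO a n + XE a (n + 1) := by
  unfold XO
  simp only [odd_eq a ha]
  rw [(summable_even a ha n).tsum_sub (summable_even a ha (n + 1))]
  simp only [XE]
  ring

theorem X_zero (a : ℝ) (ha : 1 < a) : a * (a - 1) * XE a 0 + XO a 0 = 1 := by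
  have h := ((summable_even a ha 0).hasSum.mul_left (a * (a - 1))).add (summable_odd a ha 0).hasSum
  have h2 := hasSum_XX a ha
  simp only [Nat.cast_zero] at h
  have := h.unique h2
  simpa [XE, XO] using this

theorem XO_rec (a : ℝ) (ha : 1 < a) (n : ℕ) :
    (n + 1) ^ 2 * XO a n = a * (a - 1) * XE a (n + 1) + (n + 2) ^ 2 * XO a (n + 1) := by
  have h := (((summable_even a ha (n + 1)).hasSum.mul_left (a * (a - 1))).add
    ((summable_odd a ha (n + 1)).hasSum.mul_left ((n + 2 : ℝ) ^ 2))).sub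
    ((summable_odd a ha n).hasSum.mul_left ((n + 1 : ℝ) ^ 2))
  have h2 := h.tendsto_sum_nat
  have h3 := TT_succ_lim a ha n
  have := tendsto_nhds_unique h2 (h3.congr fun N => ?_)
  · unfold XO XE
    linarith
  · rw [← sum_TT a ha]
    refine Finset.sum_congr rfl fun j _ => ?_
    have hj : (0 : ℝ) ≤ j := j.cast_nonneg
    push_cast
    simp only [bet]
    field_simp
    ring

/-- second telescoping certificate -/
noncomputable def GG (a : ℝ) (j : ℕ) : ℝ :=
  uu a j * j * (2 * (a + j) ^ 2 + 2 * a * (a + j) + a ^ 2) / ((a + j) * (a ^ 2 * (2 * a + j)))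

theorem GG_diff (a : ℝ) (ha : 1 < a) (j : ℕ) :
    GG a (j + 1) - GG a j =
      uu a j * bet 0 (a + j) + uu (a + 1) j * bet 0 (a + 1 + j) := by
  have hj : (0 : ℝ) ≤ j := j.cast_nonneg
  have hx : 0 < a + j := by linarith
  have h4 : 0 < 2 * a + j := by linarith
  unfold GG
  rw [uu_succ a ha, uu_shift a ha]
  simp only [bet]
  push_cast
  rw [show a + 1 + (j : ℝ) = a + j + 1 by ring, ← add_assoc, ← add_assoc]
  field_simp
  ring

theorem GG_lim (a : ℝ) (ha : 1 < a) : Tendsto (fun j => GG a j) atTop (nhds (2 / a ^ 2)) := by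
  have hq : Tendsto (fun j : ℕ => (j : ℝ) + a) atTop atTop :=
    tendsto_atTop_add_const_right _ _ tendsto_natCast_atTop_atTop
  have hq2 : Tendsto (fun j : ℕ => (j : ℝ) + 2 * a) atTop atTop :=
    tendsto_atTop_add_const_right _ _ tendsto_natCast_atTop_atTop
  have h := (uu_lim a ha).mul (((tendsto_const_nhds (x := 2 / a ^ 2))).add
    (((tendsto_const_nhds (x := (1 : ℝ))).div_atTop hq).mul
      ((tendsto_const_nhds (x := (1 : ℝ))).div_atTop hq2)))
  rw [show (1 : ℝ) * (2 / a ^ 2 + 0 * 0) = 2 / a ^ 2 by ring] at h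
  refine h.congr fun j => ?_
  have hj : (0 : ℝ) ≤ j := j.cast_nonneg
  have hx : 0 < a + j := by linarith
  have h4 : 0 < 2 * a + j := by linarith
  unfold GG
  rw [add_comm (j : ℝ) a, add_comm (j : ℝ) (2 * a)]
  field_simp
  ring

theorem XE_func (a : ℝ) (ha : 1 < a) : XE a 0 + XE (a + 1) 0 = 2 / a ^ 2 := by
  have h := (summable_even a ha 0).hasSum.add (summable_even (a + 1) (by linarith) 0).hasSum
  refine tendsto_nhds_unique h.tendsto_sum_nat ((GG_lim a ha).congr fun N => ?_)
  simp only [← GG_diff a ha]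
  rw [Finset.sum_range_sub]
  simp [GG]

theorem XE_bound (a : ℝ) (ha : 2 ≤ a) : XE a 0 ≤ 1 / a := by
  have h := X_zero a (by linarith)
  have h1 := XO_pos a (by linarith) 0
  have h2 := XE_pos a (by linarith) 0
  rw [le_div_iff₀ (by linarith)]
  have : 0 ≤ XE a 0 * a * (a - 2) := by
    have : 0 ≤ a - 2 := by linarith
    positivity
  nlinarith

noncomputable def kap : ℕ → ℝ
  | 0 => 1 / 4
  | n + 1 => kap n / (4 * (n + 1) ^ 2)

theorem kap_pos (n : ℕ) : 0 < kap n := by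
  induction n with
  | zero => norm_num [kap]
  | succ k ih => simp only [kap]; positivity

noncomputable def ZZ (a : ℝ) : ℕ → ℝ
  | 0 => 1
  | m + 1 => if m % 2 = 0 then kap (m / 2) * XE a (m / 2) else kap (m / 2) * XO a (m / 2)

theorem ZZ_odd (a : ℝ) (k : ℕ) : ZZ a (2 * k + 1) = kap k * XE a k := by
  simp [ZZ]

theorem ZZ_even (a : ℝ) (k : ℕ) : ZZ a (2 * k + 2) = kap k * XO a k := by
  have h1 : (2 * k + 1) % 2 = 1 := by omega
  have h2 : (2 * k + 1) / 2 = k := by omega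
  simp [ZZ, h1, h2]

theorem cf_part (s : ℝ) (hs : 1 < s) (L : ℝ)
    (hL : IsCFLimit (s ^ 2 - 1)
      (fun n => 4 * ((((n + 1) / 2 : ℕ)) : ℝ) ^ 2)
      (fun n => if n % 2 = 1 then 1 else s ^ 2 - 1) L) :
    1 = L * (XE ((1 + s) / 2) 0 / 4) := by
  set a := (1 + s) / 2 with hadef
  have ha : 1 < a := by rw [hadef]; linarith
  have hc : s ^ 2 - 1 = 4 * (a * (a - 1)) := by rw [hadef]; ring
  have hcp : 0 < s ^ 2 - 1 := by nlinarith
  have h := cf_value _ _ _ (ZZ a) L ?_ ?_ ?_ ?_ ?_ hL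
  · have h1 := ZZ_odd a 0
    simp only [mul_zero, zero_add, kap] at h1
    rw [h1] at h
    simp only [ZZ] at h
    rw [h]; ring
  · intro n
    have : 0 < (n + 1 + 1) / 2 := by omega
    have : (0 : ℝ) < ((n + 1 + 1) / 2 : ℕ) := by exact_mod_cast this
    positivity
  · intro n
    split_ifs
    · exact one_pos
    · exact hcp
  · intro n
    cases n with
    | zero => simp [ZZ]
    | succ m =>
      simp only [ZZ]
      split_ifs
      · exact mul_pos (kap_pos _) (XE_pos a ha _)
      · exact mul_pos (kap_pos _) (XO_pos a ha _)
  · have h1 := ZZ_odd a 0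
    have h2 := ZZ_even a 0
    have h3 := X_zero a ha
    simp only [mul_zero, zero_add, kap] at h1 h2
    rw [h1, h2, hc]
    norm_num [ZZ]
    linarith
  · intro n
    obtain ⟨k, rfl | rfl⟩ := Nat.even_or_odd' n
    · have e1 : (2 * k + 1) % 2 = 1 := by omega
      have e2 : (2 * k + 2 + 1) / 2 = k + 1 := by omega
      have h1 := ZZ_odd a k
      have h2 := ZZ_even a k
      have h3 := ZZ_odd a (k + 1)
      rw [show 2 * (k + 1) + 1 = 2 * k + 3 by ring] at h3
      simp only [e1, e2, if_true]
      rw [h1, h2, h3, XE_rec a ha k]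
      simp only [kap]
      push_cast
      field_simp
    · have e1 : (2 * k + 1 + 1) % 2 = 0 := by omega
      have e2 : (2 * k + 1 + 2 + 1) / 2 = k + 2 := by omega
      have h1 := ZZ_even a k
      have h2 := ZZ_odd a (k + 1)
      have h3 := ZZ_even a (k + 1)
      rw [show 2 * (k + 1) + 1 = 2 * k + 1 + 2 by ring] at h2
      rw [show 2 * (k + 1) + 2 = 2 * k + 1 + 3 by ring] at h3
      have h4 := XO_rec a ha k
      simp only [e1, e2, zero_ne_one, if_false]
      rw [show 2 * k + 1 + 1 = 2 * k + 2 by ring, h1, h2, h3, hc]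
      simp only [kap]
      push_cast
      field_simp
      rw [← h4]; ring

theorem J_eq (s : ℝ) (hs : 1 < s) : intJ s = XE ((1 + s) / 2) 0 / 4 := by
  refine eq_of_func_eq intJ (fun s => XE ((1 + s) / 2) 0 / 4) (fun t => 2 / (t + 1) ^ 2)
    (fun t ht => intJ_func t (by linarith)) (fun t ht => ?_) intJ_tendsto ?_ s hs
  · have h := XE_func ((1 + t) / 2) (by linarith)
    rw [show (1 + t) / 2 + 1 = (1 + (t + 2)) / 2 by ring] at h
    rw [← add_div, h]
    field_simp
    ring
  · have h : Tendsto (fun t : ℝ => 1 / t) atTop (nhds 0) := by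
      simpa using tendsto_inv_atTop_zero
    refine tendsto_of_tendsto_of_tendsto_of_le_of_le' tendsto_const_nhds h ?_ ?_
    · filter_upwards [eventually_gt_atTop 3] with t ht
      have := XE_pos ((1 + t) / 2) (by linarith) 0
      positivity
    · filter_upwards [eventually_gt_atTop 3] with t ht
      have h1 := XE_bound ((1 + t) / 2) (by linarith)
      have h2 : 1 / ((1 + t) / 2) ≤ 4 / t := by
        rw [div_le_div_iff₀ (by linarith) (by linarith)]
        linarith
      have h3 : 4 / t = 4 * (1 / t) := by ring
      linarith

theorem ramanujan_second_log_deriv (s : ℝ) (hs : 1 < s) (L : ℝ)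
    (hL : IsCFLimit (s ^ 2 - 1)
      (fun n => 4 * ((((n + 1) / 2 : ℕ)) : ℝ) ^ 2)
      (fun n => if n % 2 = 1 then 1 else s ^ 2 - 1) L) :
    deriv (deriv (fun t : ℝ =>
        Real.log (4 * (Real.Gamma ((3 + t) / 4) / Real.Gamma ((1 + t) / 4)) ^ 2))) s =
      -∫ x in Set.Ioi (0 : ℝ), x * Real.exp (-s * x) / Real.cosh x ∧
    deriv (deriv (fun t : ℝ =>
        Real.log (4 * (Real.Gamma ((3 + t) / 4) / Real.Gamma ((1 + t) / 4)) ^ 2))) s =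
      -(1 / L) := by
  have h1 := part_one s hs
  have h2 := cf_part s hs L hL
  have h3 := J_eq s hs
  rw [← h3] at h2
  refine ⟨h1, ?_⟩
  change deriv (deriv logB) s = _
  rw [h1]
  congr 1
  have hL0 : L ≠ 0 := by
    rintro rfl
    simp at h2
  field_simp
  linarith
end

section
/- Let φ : ℝ × (0, ∞) → ℝ be an arbitrary real-valued function. Then for all r > 0 and all (s,r) with φ(s,r) > r, 1/( φ(s,r)² − r² + TK_{n=1}^∞ (4n²r²/1 + 4n²r²/(φ(s,r)²−r²)) ) = (1/r²)·∫_0^∞ x·e^{−(φ(s,r)/r)·x}/cosh x dx, where TK_{n=1}^∞ (4n²r²/1 + 4n²r²/(φ(s,r)²−r²)) denotes the limit of the convergents of the generalized continued fraction whose partial numerators are a_{2k−1} = a_{2k} = 4k²r² and whose partial denominators are b_{2k−1} = 1 and b_{2k} = φ(s,r)² − r² for k ≥ 1. -/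
open Filter Real

namespace TK
noncomputable def J : ℕ → ℝ → ℝ
  | 0 => fun x => x
  | k + 1 => fun x => ∫ t in (0:ℝ)..x, ((k:ℝ) + 1) * (2 * sinh t * cosh t) * J k t

lemma J_cont (k : ℕ) : Continuous (J k) := by
  induction k with
  | zero => exact continuous_id
  | succ k ih =>
    have h : Continuous (fun t : ℝ => ((k:ℝ) + 1) * (2 * sinh t * cosh t) * J k t) := by
      have := Real.continuous_sinh
      have := Real.continuous_cosh
      fun_prop
    exact intervalIntegral.continuous_primitive (fun a b => h.intervalIntegrable a b) 0

lemma J_deriv (k : ℕ) (x : ℝ) :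
    HasDerivAt (J (k+1)) (((k:ℝ) + 1) * (2 * sinh x * cosh x) * J k x) x := by
  have h : Continuous (fun t : ℝ => ((k:ℝ) + 1) * (2 * sinh t * cosh t) * J k t) := by
    have := Real.continuous_sinh
    have := Real.continuous_cosh
    have := J_cont k
    fun_prop
  exact (h.integral_hasStrictDerivAt 0 x).hasDerivAt

lemma J0_deriv (x : ℝ) : HasDerivAt (J 0) 1 x := hasDerivAt_id x

lemma J_zero (k : ℕ) : J k 0 = 0 := by
  cases k <;> simp [J]

lemma eq_zero_of_deriv {f : ℝ → ℝ} (h : ∀ x, HasDerivAt f 0 x) (h0 : f 0 = 0) (x : ℝ) :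
    f x = 0 := by
  rw [← h0]
  exact is_const_of_deriv_eq_zero (fun x => (h x).differentiableAt) (fun x => (h x).deriv) x 0

lemma pos_of_deriv {f f' : ℝ → ℝ} (h : ∀ x, HasDerivAt f (f' x) x) (h0 : f 0 = 0)
    (hp : ∀ x, 0 < x → 0 < f' x) (x : ℝ) (hx : 0 < x) : 0 < f x := by
  have hm : StrictMonoOn f (Set.Ici 0) := by
    apply strictMonoOn_of_deriv_pos (convex_Ici 0)
    · exact fun y _ => (h y).continuousAt.continuousWithinAt
    · intro y hy
      rw [interior_Ici] at hy
      rw [(h y).deriv]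
      exact hp y hy
  have := hm (Set.mem_Ici.2 le_rfl) (Set.mem_Ici.2 hx.le) hx
  rwa [h0] at this

lemma J_pos (k : ℕ) : ∀ x, 0 < x → 0 < J k x := by
  induction k with
  | zero => exact fun x hx => hx
  | succ k ih =>
    refine pos_of_deriv (J_deriv k) (J_zero _) ?_
    intro x hx
    have := ih x hx
    have := Real.sinh_pos_iff.2 hx
    have := Real.cosh_pos x
    positivity

lemma M_deriv0 (x : ℝ) :
    HasDerivAt (fun x => cosh x ^ 2 * J 0 x - J 1 x) (cosh x ^ 2) x := by
  have h := (((Real.hasDerivAt_cosh x).pow 2).mul (J0_deriv x)).sub (J_deriv 0 x)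
  refine h.congr_deriv (Eq.symm ?_)
  simp; ring

lemma M_deriv (k : ℕ) (x : ℝ) :
    HasDerivAt (fun x => cosh x ^ 2 * J (k+1) x - J (k+2) x)
      (((k:ℝ) + 1) * (2 * sinh x * cosh x) * (cosh x ^ 2 * J k x - J (k+1) x)) x := by
  have h := (((Real.hasDerivAt_cosh x).pow 2).mul (J_deriv k x)).sub (J_deriv (k+1) x)
  refine h.congr_deriv (Eq.symm ?_)
  simp; ring

lemma M_pos (k : ℕ) : ∀ x, 0 < x → 0 < cosh x ^ 2 * J k x - J (k+1) x := by
  induction k with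
  | zero =>
    refine pos_of_deriv M_deriv0 (by simp [J_zero]) ?_
    intro x hx
    have := Real.cosh_pos x
    positivity
  | succ k ih =>
    refine pos_of_deriv (M_deriv k) (by simp [J_zero]) ?_
    intro x hx
    have := ih x hx
    have := Real.sinh_pos_iff.2 hx
    have := Real.cosh_pos x
    positivity

lemma R_zero (x : ℝ) : (1 + 2 * sinh x ^ 2) * J 0 x - 2 * J 1 x - sinh x * cosh x = 0 := by
  refine eq_zero_of_deriv (f := fun x => (1 + 2 * sinh x ^ 2) * J 0 x - 2 * J 1 x - sinh x * cosh x)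
    ?_ (by simp [J_zero]) x
  intro x
  have h := ((((((Real.hasDerivAt_sinh x).pow 2).const_mul 2).const_add 1).mul (J0_deriv x)).sub
    ((J_deriv 0 x).const_mul 2)).sub ((Real.hasDerivAt_sinh x).mul (Real.hasDerivAt_cosh x))
  refine h.congr_deriv (Eq.symm ?_)
  simp
  linear_combination Real.cosh_sq x

lemma R_one (x : ℝ) : 3 * (1 + 2 * sinh x ^ 2) * J 1 x - 4 * J 2 x
    - 2 * (sinh x * cosh x) ^ 2 * J 0 x = 0 := by
  refine eq_zero_of_deriv (f := fun x => 3 * (1 + 2 * sinh x ^ 2) * J 1 x - 4 * J 2 x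
    - 2 * (sinh x * cosh x) ^ 2 * J 0 x) ?_ (by simp [J_zero]) x
  intro x
  have h := ((((((((Real.hasDerivAt_sinh x).pow 2).const_mul 2).const_add 1).const_mul 3).mul
    (J_deriv 0 x)).sub ((J_deriv 1 x).const_mul 4))).sub
    (((((Real.hasDerivAt_sinh x).mul (Real.hasDerivAt_cosh x)).pow 2).const_mul 2).mul (J0_deriv x))
  refine h.congr_deriv (Eq.symm ?_)
  have hc := Real.cosh_sq x
  have hr := R_zero x
  simp
  linear_combination (-2 * sinh x * cosh x) * hr + (4 * sinh x * cosh x * J 0 x) * hc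

lemma R_succ (k : ℕ) : ∀ x : ℝ, (2 * k + 3) * (1 + 2 * sinh x ^ 2) * J (k+1) x
    - 2 * (k + 2) * J (k+2) x - 2 * (k + 1) * (sinh x * cosh x) ^ 2 * J k x = 0 := by
  induction k with
  | zero => intro x; have := R_one x; norm_num at *; linarith
  | succ k ih =>
    intro x
    refine eq_zero_of_deriv (f := fun x => (2 * (k+1:ℕ) + 3) * (1 + 2 * sinh x ^ 2) * J (k+1+1) x
    - 2 * ((k+1:ℕ) + 2) * J (k+1+2) x - 2 * ((k+1:ℕ) + 1) * (sinh x * cosh x) ^ 2 * J (k+1) x) ?_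
      (by simp [J_zero]) x
    intro x
    have h := ((((((((Real.hasDerivAt_sinh x).pow 2).const_mul 2).const_add 1).const_mul
      (2 * ((k+1:ℕ):ℝ) + 3)).mul
      (J_deriv (k+1) x)).sub ((J_deriv (k+2) x).const_mul (2 * (((k+1:ℕ):ℝ) + 2))))).sub
      (((((Real.hasDerivAt_sinh x).mul (Real.hasDerivAt_cosh x)).pow 2).const_mul
        (2 * (((k+1:ℕ):ℝ) + 1))).mul (J_deriv k x))
    refine h.congr_deriv (Eq.symm ?_)
    have hc := Real.cosh_sq x
    have hr := ih x
    simp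
    linear_combination (-(2 * sinh x * cosh x) * (k+2)) * hr
      + (4 * (k + 2) * sinh x * cosh x * J (k+1) x) * hc

noncomputable def G (k : ℕ) (x : ℝ) : ℝ := J k x / cosh x ^ (2 * k + 1)

noncomputable def P : ℕ → ℝ → ℝ
  | 0 => fun x => 1 / cosh x
  | k + 1 => fun x => 2 * ((k:ℝ) + 1) * (sinh x / cosh x) * G k x

lemma G_rec (k : ℕ) (x : ℝ) : (2 * k + 1) * (1 + (sinh x / cosh x) ^ 2) * G k x
    = 2 * (k + 1) * G (k+1) x + (sinh x / cosh x) * P k x := by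
  have hc := (Real.cosh_pos x).ne'
  have hcs := Real.cosh_sq x
  cases k with
  | zero =>
    have h := R_zero x
    simp [G, P]
    field_simp
    linear_combination h + J 0 x * hcs
  | succ k =>
    have h := R_succ k x
    simp only [G, P, show 2 * (k+1+1) + 1 = (2*k+1) + 4 by ring,
      show 2 * (k+1) + 1 = (2*k+1) + 2 by ring, pow_add _ (2*k+1)]
    push_cast
    field_simp
    linear_combination h + (2*k+3) * J (k+1) x * hcs

lemma T_deriv (x : ℝ) : HasDerivAt (fun x => sinh x / cosh x) (1 - (sinh x / cosh x)^2) x := by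
  have hc := (Real.cosh_pos x).ne'
  refine HasDerivAt.congr_deriv ((Real.hasDerivAt_sinh x).div (Real.hasDerivAt_cosh x) hc) (Eq.symm ?_)
  field_simp

lemma G_deriv (k : ℕ) (x : ℝ) :
    HasDerivAt (G k) (P k x - (2 * k + 1) * (sinh x / cosh x) * G k x) x := by
  have hc := (Real.cosh_pos x).ne'
  cases k with
  | zero =>
    refine HasDerivAt.congr_deriv ((J0_deriv x).div ((Real.hasDerivAt_cosh x).pow (2*0+1)) (pow_ne_zero _ hc)) (Eq.symm ?_)
    simp [G, P]
    field_simp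
  | succ k =>
    refine HasDerivAt.congr_deriv ((J_deriv k x).div ((Real.hasDerivAt_cosh x).pow (2*(k+1)+1)) (pow_ne_zero _ hc)) (Eq.symm ?_)
    simp only [G, P, 
      show 2 * (k+1) + 1 = (2*k+1) + 2 by ring, pow_add _ (2*k+1)]
    push_cast
    field_simp
    ring

noncomputable def A : ℕ → ℝ → ℝ
  | 0 => fun _ => 0
  | k + 1 => fun x => 4 * ((k:ℝ) + 1)^2 * (G k x - G (k+1) x)

lemma P_deriv0 (x : ℝ) : HasDerivAt (P 0) (-(sinh x / cosh x) * P 0 x) x := by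
  have hc := (Real.cosh_pos x).ne'
  refine HasDerivAt.congr_deriv ((hasDerivAt_const x (1:ℝ)).div (Real.hasDerivAt_cosh x) hc) (Eq.symm ?_)
  simp [P]
  field_simp

lemma G_deriv2 (k : ℕ) (x : ℝ) :
    HasDerivAt (fun x => P k x - (2 * k + 1) * (sinh x / cosh x) * G k x)
      (G k x + A k x - A (k+1) x) x := by
  have hr := G_rec k x
  cases k with
  | zero =>
    refine HasDerivAt.congr_deriv ((P_deriv0 x).sub (((T_deriv x).const_mul (2*((0:ℕ):ℝ)+1)).mul (G_deriv 0 x))) (Eq.symm ?_)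
    simp [A] at *
    linear_combination -2 * hr
  | succ k =>
    have hr0 := G_rec k x
    refine HasDerivAt.congr_deriv ((((T_deriv x).const_mul (2*((k:ℝ)+1))).mul (G_deriv k x)).sub
      (((T_deriv x).const_mul (2*((k+1:ℕ):ℝ)+1)).mul (G_deriv (k+1) x))) (Eq.symm ?_)
    simp [A, P] at *
    generalize sinh x / cosh x = τ at *
    linear_combination (2*(k+1)) * hr0 - 2 * (k+2) * hr

lemma G_cont (k : ℕ) : Continuous (G k) :=
  continuous_iff_continuousAt.2 fun x => (G_deriv k x).continuousAt

lemma G_pos (k : ℕ) (x : ℝ) (hx : 0 < x) : 0 < G k x := by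
  have := J_pos k x hx
  have := Real.cosh_pos x
  unfold G
  positivity

lemma G_lt (k : ℕ) (x : ℝ) (hx : 0 < x) : G (k+1) x < G k x := by
  have hM := M_pos k x hx
  have hc := Real.cosh_pos x
  have : G k x - G (k+1) x = (cosh x ^ 2 * J k x - J (k+1) x) / cosh x ^ (2 * k + 3) := by
    simp only [G, show 2 * (k+1) + 1 = (2*k+1) + 2 by ring,
      show 2 * k + 3 = (2*k+1) + 2 by ring, pow_add _ (2*k+1)]
    field_simp
  have h2 : 0 < G k x - G (k+1) x := by rw [this]; positivity
  linarith

lemma G_le (k : ℕ) (x : ℝ) (hx : 0 < x) : G k x ≤ x := by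
  induction k with
  | zero =>
    simp only [G, J]
    exact div_le_self hx.le (by simp)
  | succ k ih => exact (G_lt k x hx).le.trans ih

lemma T_bd (x : ℝ) (hx : 0 < x) : |sinh x / cosh x| ≤ 1 := by
  have hc := Real.cosh_pos x
  have hs := Real.sinh_pos_iff.2 hx
  rw [abs_of_pos (by positivity), div_le_one hc]
  exact (Real.sinh_lt_cosh x).le

lemma P_bd (k : ℕ) (x : ℝ) (hx : 0 < x) : |P k x| ≤ (2 * k + 1) * (1 + x) := by
  cases k with
  | zero =>
    simp only [P]
    have hc := Real.cosh_pos x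
    rw [abs_of_pos (by positivity), div_le_iff₀ hc]
    have := Real.one_le_cosh x
    simp
    nlinarith
  | succ k =>
    simp only [P]
    have h1 := T_bd x hx
    have h2 := G_le k x hx
    have h3 := G_pos k x hx
    rw [abs_mul, abs_mul, abs_of_pos h3, abs_of_pos (by positivity : (0:ℝ) < 2 * ((k:ℝ)+1))]
    have : |sinh x / cosh x| * G k x ≤ 1 * x := by gcongr
    push_cast
    nlinarith [mul_le_mul_of_nonneg_left this (by positivity : (0:ℝ) ≤ 2 * ((k:ℝ)+1))]

lemma integ_x {c : ℝ} (hc : 0 < c) :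
    MeasureTheory.IntegrableOn (fun x : ℝ => exp (-c * x) * x) (Set.Ioi 0) := by
  have := integrableOn_rpow_mul_exp_neg_mul_rpow (s := 1) (p := 1) (b := c) (by norm_num)
    (by norm_num) hc
  simpa [mul_comm] using this

lemma integ_G {c : ℝ} (hc : 0 < c) (k : ℕ) :
    MeasureTheory.IntegrableOn (fun x : ℝ => exp (-c * x) * G k x) (Set.Ioi 0) := by
  refine MeasureTheory.Integrable.mono' (integ_x hc) ?_ ?_
  · have := G_cont k
    exact Continuous.aestronglyMeasurable (by fun_prop)
  · filter_upwards [MeasureTheory.ae_restrict_mem measurableSet_Ioi] with x hx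
    have hx : 0 < x := hx
    have h3 := G_pos k x hx
    rw [Real.norm_of_nonneg (by positivity)]
    gcongr
    exact G_le k x hx

noncomputable def H (c : ℝ) (k : ℕ) : ℝ := ∫ x in Set.Ioi (0:ℝ), exp (-c * x) * G k x

lemma int_pos {f : ℝ → ℝ} (hi : MeasureTheory.IntegrableOn f (Set.Ioi 0))
    (hp : ∀ x, 0 < x → 0 < f x) : 0 < ∫ x in Set.Ioi (0:ℝ), f x := by
  rw [MeasureTheory.setIntegral_pos_iff_support_of_nonneg_ae _ hi]
  · have : Set.Ioi (0:ℝ) ⊆ Function.support f ∩ Set.Ioi 0 := fun x hx => ⟨(hp x hx).ne', hx⟩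
    refine lt_of_lt_of_le ?_ (MeasureTheory.measure_mono this)
    simp
  · filter_upwards [MeasureTheory.ae_restrict_mem measurableSet_Ioi] with x hx
    exact (hp x hx).le

lemma H_pos {c : ℝ} (hc : 0 < c) (k : ℕ) : 0 < H c k :=
  int_pos (integ_G hc k) fun x hx => mul_pos (exp_pos _) (G_pos k x hx)

lemma H_lt {c : ℝ} (hc : 0 < c) (k : ℕ) : H c (k+1) < H c k := by
  have : 0 < H c k - H c (k+1) := by
    unfold H
    rw [← MeasureTheory.integral_sub (integ_G hc k) (integ_G hc (k+1))]
    refine int_pos ((integ_G hc k).sub (integ_G hc (k+1))) fun x hx => ?_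
    have := G_lt k x hx
    have := exp_pos (-c * x)
    nlinarith
  linarith

lemma tend {c K : ℝ} (hc : 0 < c) {g : ℝ → ℝ} (hg : ∀ x, 0 < x → |g x| ≤ K * (1 + x)) :
    Tendsto (fun x => exp (-c * x) * g x) atTop (nhds 0) := by
  have h1 := tendsto_rpow_mul_exp_neg_mul_atTop_nhds_zero 1 c hc
  have h0 := tendsto_rpow_mul_exp_neg_mul_atTop_nhds_zero 0 c hc
  have h := (h0.add h1).const_mul K
  simp only [rpow_one, rpow_zero, add_zero, mul_zero] at h
  refine squeeze_zero_norm' ?_ h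
  filter_upwards [eventually_gt_atTop 0] with x hx
  rw [norm_mul, Real.norm_of_nonneg (exp_pos _).le, Real.norm_eq_abs]
  calc _ ≤ exp (-c * x) * (K * (1 + x)) := by gcongr; exact hg x hx
    _ = _ := by ring

lemma integ_A {c : ℝ} (hc : 0 < c) (k : ℕ) :
    MeasureTheory.IntegrableOn (fun x : ℝ => exp (-c * x) * A k x) (Set.Ioi 0) := by
  cases k with
  | zero => simp [A]
  | succ k =>
    refine (((integ_G hc k).sub (integ_G hc (k+1))).const_mul (4 * ((k:ℝ) + 1)^2)).congr ?_
    refine Eventually.of_forall fun x => ?_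
    simp [A]; ring

lemma int_A {c : ℝ} (hc : 0 < c) (k : ℕ) :
    ∫ x in Set.Ioi (0:ℝ), exp (-c * x) * A (k+1) x = 4 * ((k:ℝ) + 1)^2 * (H c k - H c (k+1)) := by
  unfold H
  rw [← MeasureTheory.integral_sub (integ_G hc k) (integ_G hc (k+1)),
    ← MeasureTheory.integral_const_mul]
  congr 1
  ext x
  simp [A]; ring

lemma main_int {c : ℝ} (hc : 0 < c) (k : ℕ) :
    (c^2 - 1) * H c k - (∫ x in Set.Ioi (0:ℝ), exp (-c * x) * A k x)
      + 4 * ((k:ℝ) + 1)^2 * (H c k - H c (k+1)) = P k 0 := by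
  have hd : ∀ x ∈ Set.Ici (0:ℝ), HasDerivAt
      (fun x => exp (-c * x) * (-(P k x - (2 * k + 1) * (sinh x / cosh x) * G k x) - c * G k x))
      ((c^2 - 1) * (exp (-c * x) * G k x) - exp (-c * x) * A k x + exp (-c * x) * A (k+1) x) x := by
    intro x _
    have he : HasDerivAt (fun x => exp (-c * x)) (exp (-c * x) * (-c)) x := by
      simpa using ((hasDerivAt_id x).const_mul (-c)).exp
    refine (he.mul ((G_deriv2 k x).neg.sub ((G_deriv k x).const_mul c))).congr_deriv ?_
    simp
    ring
  have hi := (((integ_G hc k).const_mul (c^2-1)).sub (integ_A hc k)).add (integ_A hc (k+1))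
  have ht : Tendsto (fun x => exp (-c * x) *
      (-(P k x - (2 * k + 1) * (sinh x / cosh x) * G k x) - c * G k x)) atTop (nhds 0) := by
    refine tend (K := (2 * k + 1) + (2 * k + 1) + c) hc fun x hx => ?_
    have h1 := P_bd k x hx
    have h2 := G_pos k x hx
    have h3 := G_le k x hx
    have h4 := T_bd x hx
    have h5 : |(2 * k + 1) * (sinh x / cosh x) * G k x| ≤ (2 * k + 1) * (1 + x) := by
      rw [abs_mul, abs_mul, abs_of_pos h2, abs_of_pos (by positivity : (0:ℝ) < 2 * (k:ℝ) + 1)]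
      calc _ ≤ (2 * (k:ℝ) + 1) * 1 * (1 + x) := by gcongr; linarith
        _ = _ := by ring
    have h6 : c * G k x ≤ c * (1 + x) := by gcongr; linarith
    have h7 : 0 < c * G k x := by positivity
    rw [abs_le] at *
    constructor <;> linarith [h1.1, h1.2, h5.1, h5.2]
  have key := MeasureTheory.integral_Ioi_of_hasDerivAt_of_tendsto' hd hi ht
  have hi2 : MeasureTheory.Integrable (fun x => (c^2-1) * (exp (-c * x) * G k x)
      - exp (-c * x) * A k x) (MeasureTheory.volume.restrict (Set.Ioi 0)) :=
    ((integ_G hc k).const_mul (c^2-1)).sub (integ_A hc k)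
  rw [MeasureTheory.integral_add hi2 (integ_A hc (k+1)), MeasureTheory.integral_sub ((integ_G hc k).const_mul (c^2-1))
    (integ_A hc k), MeasureTheory.integral_const_mul, int_A hc k] at key
  have hG0 : G k 0 = 0 := by simp [G, J_zero]
  unfold H at *
  rw [key]
  simp [hG0]

/-- positive tails sequence -/
noncomputable def κ (r : ℝ) (k : ℕ) : ℝ := 1 / (4 ^ k * (Nat.factorial k : ℝ)^2 * r ^ (2 * k + 2))

lemma κ_pos {r : ℝ} (hr : 0 < r) (k : ℕ) : 0 < κ r k := by
  unfold κ; positivity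

lemma κ_succ {r : ℝ} (hr : 0 < r) (k : ℕ) : κ r k = 4 * ((k:ℝ)+1)^2 * r^2 * κ r (k+1) := by
  unfold κ
  rw [Nat.factorial_succ]
  push_cast
  have : (Nat.factorial k : ℝ) ≠ 0 := by positivity
  field_simp
  ring

noncomputable def f (c r : ℝ) (n : ℕ) : ℝ :=
  if n % 2 = 0 then κ r (n/2) * H c (n/2) else κ r (n/2) * (H c (n/2) - H c (n/2+1))

lemma f_pos {c r : ℝ} (hc : 0 < c) (hr : 0 < r) (n : ℕ) : 0 < f c r n := by
  unfold f
  have := κ_pos hr (n/2)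
  have := H_pos hc (n/2)
  have := sub_pos.2 (H_lt hc (n/2))
  split_ifs <;> positivity

lemma f_start {c r : ℝ} (hc : 0 < c) (hr : 0 < r) :
    1 = (r^2 * (c^2 - 1)) * f c r 0 + 4 * r^2 * f c r 1 := by
  have := main_int hc 0
  simp [A, P] at this
  simp [f, κ]
  field_simp
  linarith

lemma f_rec {c r : ℝ} (hc : 0 < c) (hr : 0 < r) (n : ℕ) :
    f c r n = (if (n+1) % 2 = 1 then 1 else r^2 * (c^2-1)) * f c r (n+1)
      + (4 * ((((n + 2 + 1) / 2 : ℕ)) : ℝ) ^ 2 * r ^ 2) * f c r (n+2) := by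
  rcases Nat.even_or_odd' n with ⟨k, rfl | rfl⟩
  · unfold f
    rw [if_pos (by omega), if_pos (by omega), if_neg (by omega), if_pos (by omega),
      show 2 * k / 2 = k by omega, show (2 * k + 1) / 2 = k by omega,
      show (2 * k + 2) / 2 = k + 1 by omega, show (2 * k + 2 + 1) / 2 = k + 1 by omega,
      κ_succ hr k]
    push_cast
    ring
  · unfold f
    rw [if_neg (by omega), if_neg (by omega), if_pos (by omega), if_neg (by omega),
      show (2 * k + 1) / 2 = k by omega, show (2 * k + 1 + 1) / 2 = k + 1 by omega,
      show (2 * k + 1 + 2) / 2 = k + 1 by omega, show (2 * k + 1 + 2 + 1) / 2 = k + 2 by omega,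
      κ_succ hr k]
    have h := main_int hc (k+1)
    rw [int_A hc k] at h
    simp [P] at h
    push_cast
    linear_combination (-r^2 * κ r (k+1)) * h

lemma cf_unique {a b F : ℕ → ℝ} {L : ℝ} (ha : ∀ n, 0 < a (n+1)) (hb : ∀ n, 0 < b (n+1))
    (hF : ∀ n, 0 < F n) (hrec : ∀ n, F n = b (n+1) * F (n+1) + a (n+2) * F (n+2))
    (hL : IsCFLimit 0 a b L) : L = a 1 * F 1 / F 0 := by
  have hD2 : ∀ n, 0 < cfDen a b n ∧ 0 < cfDen a b (n+1) := by
    intro n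
    induction n with
    | zero => exact ⟨by simp [cfDen], by simpa [cfDen] using hb 0⟩
    | succ n ih =>
      refine ⟨ih.2, ?_⟩
      rw [cfDen]
      have := ha (n+1)
      have := hb (n+1)
      have := ih.1
      have := ih.2
      positivity
  have hD := fun n => (hD2 n).1
  have iD : ∀ n, F (n+1) * cfDen a b (n+1) + a (n+2) * F (n+2) * cfDen a b n = F 0 := by
    intro n
    induction n with
    | zero => simp [cfDen]; rw [hrec 0]; ring
    | succ n ih =>
      rw [← ih, hrec (n+1), cfDen]; ring
  have iN : ∀ n, F (n+1) * cfNum 0 a b (n+1) + a (n+2) * F (n+2) * cfNum 0 a b n = a 1 * F 1 := by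
    intro n
    induction n with
    | zero => simp [cfNum]; ring
    | succ n ih =>
      rw [← ih, hrec (n+1), cfNum]; ring
  unfold IsCFLimit at hL
  have hL1 := hL.comp (tendsto_add_atTop_nat 1)
  have hmin := hL.min hL1
  have hmax := hL.max hL1
  rw [min_self] at hmin
  rw [max_self] at hmax
  have e : ∀ n, cfNum 0 a b n = cfNum 0 a b n / cfDen a b n * cfDen a b n := fun n => by
    rw [div_mul_cancel₀ _ (hD n).ne']
  apply le_antisymm
  · refine le_of_tendsto hmin (Eventually.of_forall fun n => ?_)
    simp only [Function.comp]
    rw [le_div_iff₀ (hF 0), ← iD n, ← iN n]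
    have e0 := e n
    have e1 := e (n+1)
    set x := cfNum 0 a b n / cfDen a b n
    set y := cfNum 0 a b (n+1) / cfDen a b (n+1)
    have h1 : 0 < F (n+1) * cfDen a b (n+1) := mul_pos (hF _) (hD _)
    have h2 : 0 < a (n+2) * F (n+2) * cfDen a b n := mul_pos (mul_pos (ha _) (hF _)) (hD _)
    have h3 := mul_le_mul_of_nonneg_left (min_le_left x y) h2.le
    have h4 := mul_le_mul_of_nonneg_left (min_le_right x y) h1.le
    rw [e0, e1]
    linarith
  · refine ge_of_tendsto hmax (Eventually.of_forall fun n => ?_)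
    simp only [Function.comp]
    rw [div_le_iff₀ (hF 0), ← iD n, ← iN n]
    have e0 := e n
    have e1 := e (n+1)
    set x := cfNum 0 a b n / cfDen a b n
    set y := cfNum 0 a b (n+1) / cfDen a b (n+1)
    have h1 : 0 < F (n+1) * cfDen a b (n+1) := mul_pos (hF _) (hD _)
    have h2 : 0 < a (n+2) * F (n+2) * cfDen a b n := mul_pos (mul_pos (ha _) (hF _)) (hD _)
    have h3 := mul_le_mul_of_nonneg_left (le_max_left x y) h2.le
    have h4 := mul_le_mul_of_nonneg_left (le_max_right x y) h1.le
    rw [e0, e1]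
    linarith
end TK

theorem tk_integral_representation (φ : ℝ → ℝ → ℝ) (s r : ℝ) (hr : 0 < r)
    (hφ : r < φ s r) (L : ℝ)
    (hL : IsCFLimit 0
      (fun n => 4 * ((((n + 1) / 2 : ℕ)) : ℝ) ^ 2 * r ^ 2)
      (fun n => if n % 2 = 1 then 1 else (φ s r) ^ 2 - r ^ 2) L) :
    1 / ((φ s r) ^ 2 - r ^ 2 + L) =
      (1 / r ^ 2) * ∫ x in Set.Ioi (0 : ℝ),
        x * Real.exp (-(φ s r / r) * x) / Real.cosh x := by
  generalize φ s r = p at *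
  have hp : 0 < p := hr.trans hφ
  have hc : 0 < p / r := by positivity
  have hu : r^2 * ((p/r)^2 - 1) = p^2 - r^2 := by field_simp
  have hu0 : 0 < p^2 - r^2 := by nlinarith
  have hF0 := TK.f_pos hc hr 0
  have key := TK.cf_unique (F := TK.f (p/r) r) ?_ ?_ (TK.f_pos hc hr) ?_ hL
  · have h1 := TK.f_start hc hr
    rw [hu] at h1
    have h2 : TK.f (p/r) r 0 = (1 / r ^ 2) * ∫ x in Set.Ioi (0 : ℝ),
        x * Real.exp (-(p / r) * x) / Real.cosh x := by
      simp only [TK.f, TK.κ, TK.H, TK.G, TK.J]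
      simp
      left
      congr 1
      ext x
      rw [show TK.J 0 x = x from rfl]
      ring
    rw [← h2, key]
    have h3 : p^2 - r^2 + 4 * (((1 + 1) / 2 : ℕ) : ℝ)^2 * r^2 * TK.f (p/r) r 1 / TK.f (p/r) r 0
        = 1 / TK.f (p/r) r 0 := by
      field_simp
      norm_num
      linarith
    rw [h3, one_div_one_div]
  · intro n
    have : 0 < (n + 1 + 1) / 2 := by omega
    have : (0:ℝ) < (((n + 1 + 1) / 2 : ℕ) : ℝ) := by exact_mod_cast this
    positivity
  · intro n
    split_ifs
    · norm_num
    · exact hu0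
  · intro n
    have := TK.f_rec hc hr n
    rw [hu] at this
    exact this
end
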